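/- arXiv:2401.01628 — 6 statements merged into one kernel-verified Lean document; each statement's English description precedes it below -/
import Mathlib

section
/- (Lebesgue Measure Leibniz Rule.) Let f(s,x) be defined on [α,β] × [a,b], bounded in absolute value, and for each s ∈ [α,β] let x ↦ f(s,x) be Lebesgue integrable on [a,b]. Let g, h : [α,β] → [a,b] be Lipschitz continuous. Suppose there is a set E₀ ⊂ [a,b] of Lebesgue measure zero such that the partial derivative ∂f(s,x)/∂s exists for all s ∈ (α,β) and all x ∈ [a,b] ∖ E₀, and is bounded in absolute value on (α,β) × [a,b]. Define φ(s) = ∫_{h(s)}^{g(s)} f(s,x) dx. Then for almost every s ∈ (α,β), the derivative dφ(s)/ds exists and equals f(s, g(s)) g′(s) − f(s, h(s)) h′(s) + ∫_{[h(s), g(s)] ∖ E₀} ∂f(s,x)/∂s dx. -/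
open MeasureTheory intervalIntegral
open Set Filter Topology Asymptotics

/-- A real function has zero derivative at almost every point of the preimage of a null set. -/
theorem ae_deriv_eq_zero_of_mem_null (g : ℝ → ℝ) {N : Set ℝ} (hN : volume N = 0) :
    ∀ᵐ s, g s ∈ N → deriv g s = 0 := by
  let A : ℕ → Set ℝ := fun n =>
    {s | g s ∈ N ∧ ∀ t, |t - s| < 1 / ((n : ℝ) + 1) → |t - s| ≤ ((n : ℝ) + 1) * |g t - g s|}
  have null_piece (n : ℕ) (q : ℚ) :
      volume (A n ∩ Metric.ball (q : ℝ) (1 / ((n : ℝ) + 1) / 2)) = 0 := by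
    set B := A n ∩ Metric.ball (q : ℝ) (1 / ((n : ℝ) + 1) / 2)
    have expand : ∀ s ∈ B, ∀ t ∈ B, |t - s| ≤ ((n : ℝ) + 1) * |g t - g s| := by
      rintro s ⟨hs, hsq⟩ t ⟨-, htq⟩
      apply hs.2
      rw [Metric.mem_ball, Real.dist_eq] at hsq htq
      rw [abs_lt] at *
      constructor <;> linarith [hsq.1, hsq.2, htq.1, htq.2]
    have inj : InjOn g B := by
      intro s hs t ht hst
      have := expand s hs t ht
      rw [hst, sub_self, abs_zero, mul_zero] at this
      linarith [abs_eq_zero.1 (le_antisymm this (abs_nonneg _))]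
    have lip : LipschitzOnWith ((n : NNReal) + 1) (Function.invFunOn g B) (g '' B) := by
      apply LipschitzOnWith.of_dist_le_mul
      rintro _ ⟨s, hs, rfl⟩ _ ⟨t, ht, rfl⟩
      rw [inj.leftInvOn_invFunOn hs, inj.leftInvOn_invFunOn ht]
      simpa [Real.dist_eq] using expand t ht s hs
    have image_null : volume (g '' B) = 0 :=
      measure_mono_null (by rintro _ ⟨s, hs, rfl⟩; exact hs.1.1) hN
    have le := lip.hausdorffMeasure_image_le zero_le_one
    rw [hausdorffMeasure_real, image_null, mul_zero, inj.invFunOn_image subset_rfl] at le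
    exact le_antisymm le zero_le
  have null_union : volume (⋃ n : ℕ, ⋃ q : ℚ,
      A n ∩ Metric.ball (q : ℝ) (1 / ((n : ℝ) + 1) / 2)) = 0 :=
    measure_iUnion_null fun n => measure_iUnion_null (null_piece n)
  refine measure_mono_null ?_ null_union
  intro s hs
  simp only [mem_compl_iff, mem_ofPred_eq, Classical.not_imp] at hs
  obtain ⟨hsN, hs0⟩ := hs
  have hd := (differentiableAt_of_deriv_ne_zero hs0).hasDerivAt
  obtain ⟨C, hC⟩ := (hd.isTheta_sub hs0).2.bound
  rw [prod_pure, eventually_map] at hC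
  obtain ⟨ε, hε, hball⟩ := Metric.eventually_nhds_iff.1 hC
  obtain ⟨n₁, hn₁⟩ := exists_nat_one_div_lt hε
  obtain ⟨n₂, hn₂⟩ := exists_nat_ge C
  simp only [mem_iUnion]
  set n := max n₁ n₂
  have hn1 : (n₁ : ℝ) ≤ n := by exact_mod_cast le_max_left _ _
  have hn2 : (n₂ : ℝ) ≤ n := by exact_mod_cast le_max_right _ _
  have hpos : (0 : ℝ) < 1 / ((n : ℝ) + 1) / 2 := by positivity
  obtain ⟨q, hq₁, hq₂⟩ := exists_rat_btwn (show s < s + 1 / ((n : ℝ) + 1) / 2 by linarith)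
  refine ⟨n, q, ⟨hsN, fun t ht => ?_⟩, ?_⟩
  · have hlt : 1 / ((n : ℝ) + 1) ≤ 1 / ((n₁ : ℝ) + 1) := by gcongr
    have := hball (show dist t s < ε by rw [Real.dist_eq]; linarith)
    rw [Real.norm_eq_abs, Real.norm_eq_abs] at this
    exact this.trans (mul_le_mul_of_nonneg_right (by linarith) (abs_nonneg _))
  · rw [Metric.mem_ball, Real.dist_eq, abs_lt]
    constructor <;> linarith

/-- Lebesgue's differentiation theorem, with one null set serving every function of a family
that is Lipschitz in the parameter. -/
theorem ae_forall_hasDerivAt_integral {α β a b K : ℝ} {f : ℝ → ℝ → ℝ} (hab : a ≤ b)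
    (hint : ∀ s ∈ Ioo α β, IntervalIntegrable (f s) volume a b)
    (hlip : ∀ᵐ x, x ∈ Icc a b → ∀ s ∈ Ioo α β, ∀ t ∈ Ioo α β, |f s x - f t x| ≤ K * |s - t|) :
    ∀ᵐ x, x ∈ Icc a b → ∀ s ∈ Ioo α β,
      HasDerivAt (fun y => ∫ z in a..y, f s z) (f s x) x := by
  have rational : ∀ᵐ x, ∀ q : ℚ, (q : ℝ) ∈ Ioo α β → x ∈ Icc a b →
      HasDerivAt (fun y => ∫ z in a..y, f q z) (f q x) x := by
    refine ae_all_iff.2 fun q => ?_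
    by_cases hq : (q : ℝ) ∈ Ioo α β
    · filter_upwards [(hint q hq).ae_hasDerivAt_integral] with x hx _ hxab
      rw [uIcc_of_le hab] at hx
      exact hx hxab a (left_mem_Icc.2 hab)
    · exact Eventually.of_forall fun x h => absurd h hq
  have ne_a : ∀ᵐ x : ℝ, x ≠ a := by simp [ae_iff, measure_singleton]
  have ne_b : ∀ᵐ x : ℝ, x ≠ b := by simp [ae_iff, measure_singleton]
  filter_upwards [rational, ne_a, ne_b, hlip] with x hx hxa hxb hxlip hxab s hs
  rw [hasDerivAt_iff_isLittleO, isLittleO_iff]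
  intro ε hε
  have hK : 0 < 4 * (|K| + 1) := by positivity
  obtain ⟨q, hsq, hq⟩ := exists_rat_btwn
    (show s < min β (s + ε / (4 * (|K| + 1))) from lt_min hs.2 (by linarith [div_pos hε hK]))
  have hqm : (q : ℝ) ∈ Ioo α β := ⟨hs.1.trans hsq, hq.trans_le (min_le_left _ _)⟩
  have close : K * |s - q| ≤ ε / 4 := by
    have h₁ : |s - q| ≤ ε / (4 * (|K| + 1)) := by
      rw [abs_of_neg (by linarith)]
      linarith [hq.trans_le (min_le_right β _)]
    calc K * |s - q| ≤ (|K| + 1) * |s - q| := by gcongr; linarith [le_abs_self K]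
      _ ≤ (|K| + 1) * (ε / (4 * (|K| + 1))) := by gcongr
      _ = ε / 4 := by field_simp
  have deriv_q := isLittleO_iff.1 (hasDerivAt_iff_isLittleO.1 (hx q hqm hxab)) (half_pos hε)
  have nhds : Icc a b ∈ 𝓝 x :=
    Icc_mem_nhds (lt_of_le_of_ne hxab.1 hxa.symm) (lt_of_le_of_ne hxab.2 hxb)
  filter_upwards [deriv_q, nhds] with y hy hyab
  have sub_int {t u v : ℝ} (ht : t ∈ Ioo α β) (hu : u ∈ Icc a b) (hv : v ∈ Icc a b) :
      IntervalIntegrable (f t) volume u v :=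
    (hint t ht).mono_set (by rw [uIcc_of_le hab]; exact ordConnected_Icc.uIcc_subset hu hv)
  have ha : a ∈ Icc a b := left_mem_Icc.2 hab
  have diff : ‖∫ z in x..y, (f s z - f q z)‖ ≤ ε / 4 * |y - x| := by
    refine intervalIntegral.norm_integral_le_of_norm_le_const_ae ?_
    filter_upwards [hlip] with z hz hzm
    exact (hz (ordConnected_Icc.uIcc_subset hxab hyab (uIoc_subset_uIcc hzm)) s hs q hqm).trans
      close
  have point : |(y - x) * (f s x - f q x)| ≤ ε / 4 * |y - x| := by
    rw [abs_mul, mul_comm]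
    gcongr
    exact (hxlip hxab s hs q hqm).trans close
  rw [intervalIntegral.integral_sub (sub_int hs hxab hyab) (sub_int hqm hxab hyab),
    Real.norm_eq_abs] at diff
  rw [intervalIntegral.integral_interval_sub_left (sub_int hqm ha hyab) (sub_int hqm ha hxab),
    Real.norm_eq_abs, Real.norm_eq_abs, smul_eq_mul] at hy
  rw [intervalIntegral.integral_interval_sub_left (sub_int hs ha hyab) (sub_int hs ha hxab),
    Real.norm_eq_abs, Real.norm_eq_abs, smul_eq_mul]
  rw [abs_le] at *
  constructor <;> nlinarith [diff.1, diff.2, point.1, point.2, hy.1, hy.2]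

/-- Derivative of an integral with a moving endpoint, at the parameter where the interval
degenerates. -/
theorem hasDerivAt_integral_moving_endpoint {F : ℝ → ℝ → ℝ} {g : ℝ → ℝ} {g' s a K M : ℝ}
    (hg : HasDerivAt g g' s)
    (hint : ∀ᶠ t in 𝓝 s, IntervalIntegrable (F t) volume (g s) (g t))
    (hint_s : ∀ᶠ t in 𝓝 s, IntervalIntegrable (F s) volume (g s) (g t))
    (hint_a : IntervalIntegrable (F s) volume a (g s))
    (hlip : ∀ᶠ t in 𝓝 s, ∀ᵐ x, x ∈ uIoc (g s) (g t) → |F t x - F s x| ≤ K * |t - s|)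
    (hbdd : ∀ᶠ t in 𝓝 s, ∀ x ∈ uIoc (g s) (g t), |F s x| ≤ M)
    (hF : g' = 0 ∨ HasDerivAt (fun y => ∫ x in a..y, F s x) (F s (g s)) (g s)) :
    HasDerivAt (fun t => ∫ x in g s..g t, F t x) (F s (g s) * g') s := by
  have remainder : HasDerivAt (fun t => ∫ x in g s..g t, (F t x - F s x)) 0 s := by
    have big : (fun t => ∫ x in g s..g t, (F t x - F s x)) =O[𝓝 s] fun t => ‖t - s‖ ^ 2 := by
      have h₁ : (fun t => ∫ x in g s..g t, (F t x - F s x)) =O[𝓝 s]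
          fun t => (t - s) * (g t - g s) := by
        refine IsBigO.of_bound K ?_
        filter_upwards [hlip] with t ht
        have := intervalIntegral.norm_integral_le_of_norm_le_const_ae
          (f := fun x => F t x - F s x) ht
        rwa [norm_mul, ← mul_assoc]
      refine h₁.trans (((isBigO_refl _ _).mul hg.isBigO_sub).trans ?_)
      exact IsBigO.of_bound 1 (Eventually.of_forall fun t => by simp [sq])
    simpa using (big.hasFDerivAt one_lt_two).hasDerivAt
  have main : HasDerivAt (fun t => ∫ x in g s..g t, F s x) (F s (g s) * g') s := by
    rcases hF with rfl | hF
    · rw [mul_zero, hasDerivAt_iff_isLittleO]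
      have small : (fun t => g t - g s) =o[𝓝 s] fun t => t - s := by
        simpa [hasDerivAt_iff_isLittleO] using hg
      refine IsBigO.trans_isLittleO (IsBigO.of_bound M ?_) small
      filter_upwards [hbdd] with t ht
      simpa using intervalIntegral.norm_integral_le_of_norm_le_const (f := F s) ht
    · refine ((hF.comp s hg).sub_const (∫ x in a..g s, F s x)).congr_of_eventuallyEq ?_
      filter_upwards [hint_s] with t ht
      rw [Function.comp_apply, ← intervalIntegral.integral_add_adjacent_intervals hint_a ht]
      ring
  have sum := main.add remainder
  rw [add_zero] at sum
  refine sum.congr_of_eventuallyEq ?_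
  filter_upwards [hint, hint_s] with t ht hts
  simp only [Pi.add_apply]
  rw [intervalIntegral.integral_sub ht hts]
  ring


/-- **Lebesgue Measure Leibniz Rule.**  Let `f(s,x)` be bounded on `[α,β] × [a,b]` and,
for each `s`, Lebesgue integrable in `x` on `[a,b]`.  Let `g, h : [α,β] → [a,b]` be
Lipschitz, with `h(s) ≤ g(s)`.  Suppose that off an exceptional set `E₀ ⊆ [a,b]` of
Lebesgue measure zero, the partial derivative `∂f(s,x)/∂s = f'(s,x)` exists for all
`s ∈ (α,β)`, and that it is bounded in absolute value by `K` on `(α,β) × [a,b]`.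
Then, with `φ(s) = ∫_{h(s)}^{g(s)} f(s,x) dx`, for almost every `s ∈ (α,β)` the
derivative `φ'(s)` exists and equals
`f(s, g(s)) g'(s) - f(s, h(s)) h'(s) + ∫_{[h(s),g(s)] \ E₀} f'(s,x) dx`. -/
theorem lebesgue_leibniz_rule
    (α β a b M K : ℝ)
    (f f' : ℝ → ℝ → ℝ)
    (g h : ℝ → ℝ) (Lg Lh : NNReal)
    (E₀ : Set ℝ)
    (hE₀_null : volume E₀ = 0) (hE₀_sub : E₀ ⊆ Set.Icc a b)
    (hf_bdd : ∀ s ∈ Set.Icc α β, ∀ x ∈ Set.Icc a b, |f s x| ≤ M)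
    (hf_int : ∀ s ∈ Set.Icc α β, IntegrableOn (fun x => f s x) (Set.Icc a b) volume)
    (hg_lip : LipschitzOnWith Lg g (Set.Icc α β))
    (hh_lip : LipschitzOnWith Lh h (Set.Icc α β))
    (hg_mem : ∀ s ∈ Set.Icc α β, g s ∈ Set.Icc a b)
    (hh_mem : ∀ s ∈ Set.Icc α β, h s ∈ Set.Icc a b)
    (h_le : ∀ s ∈ Set.Icc α β, h s ≤ g s)
    (hf' : ∀ s ∈ Set.Ioo α β, ∀ x ∈ Set.Icc a b \ E₀,
      HasDerivAt (fun t => f t x) (f' s x) s)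
    (hf'_bdd : ∀ s ∈ Set.Ioo α β, ∀ x ∈ Set.Icc a b, |f' s x| ≤ K) :
    ∀ᵐ s ∂volume, s ∈ Set.Ioo α β →
      HasDerivAt (fun t => ∫ x in h t..g t, f t x)
        (f s (g s) * deriv g s - f s (h s) * deriv h s
          + ∫ x in Set.Icc (h s) (g s) \ E₀, f' s x) s := by
  rcases lt_or_ge α β with hαβ | hαβ
  swap
  · exact Eventually.of_forall fun s hs => absurd (hs.1.trans hs.2) hαβ.not_gt
  have hab : a ≤ b :=
    (hg_mem α (left_mem_Icc.2 hαβ.le)).1.trans (hg_mem α (left_mem_Icc.2 hαβ.le)).2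
  have sub_int {t u v : ℝ} (ht : t ∈ Ioo α β) (hu : u ∈ Icc a b) (hv : v ∈ Icc a b) :
      IntervalIntegrable (f t) volume u v :=
    ((hf_int t (Ioo_subset_Icc_self ht)).mono_set
      (ordConnected_Icc.uIcc_subset hu hv)).intervalIntegrable
  have notMem_E₀ : ∀ᵐ x, x ∉ E₀ := measure_eq_zero_iff_ae_notMem.1 hE₀_null
  have hlip : ∀ᵐ x, x ∈ Icc a b →
      ∀ s ∈ Ioo α β, ∀ t ∈ Ioo α β, |f s x - f t x| ≤ K * |s - t| := by
    filter_upwards [notMem_E₀] with x hx hxab s hs t ht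
    exact (convex_Ioo α β).norm_image_sub_le_of_norm_hasDerivWithin_le
      (fun u hu => (hf' u hu x ⟨hxab, hx⟩).hasDerivWithinAt) (fun u hu => hf'_bdd u hu x hxab) ht hs
  have hLeb := ae_forall_hasDerivAt_integral hab
    (fun s hs => sub_int hs (left_mem_Icc.2 hab) (right_mem_Icc.2 hab)) hlip
  have endpoint {k : ℝ → ℝ} {L : NNReal} (hk : LipschitzOnWith L k (Icc α β))
      (hk_mem : ∀ s ∈ Icc α β, k s ∈ Icc a b) :
      ∀ᵐ s, s ∈ Ioo α β →
        HasDerivAt (fun t => ∫ x in k s..k t, f t x) (f s (k s) * deriv k s) s := by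
    filter_upwards [hk.ae_differentiableWithinAt_of_mem_real,
      ae_deriv_eq_zero_of_mem_null k (ae_iff.1 hLeb)] with s hdiff hnull hs
    have hd := ((hdiff (Ioo_subset_Icc_self hs)).differentiableAt
      (Icc_mem_nhds hs.1 hs.2)).hasDerivAt
    have nhds : ∀ᶠ t in 𝓝 s, t ∈ Ioo α β := Ioo_mem_nhds hs.1 hs.2
    have hks := hk_mem s (Ioo_subset_Icc_self hs)
    have mem {t x : ℝ} (ht : t ∈ Ioo α β) (hx : x ∈ uIoc (k s) (k t)) : x ∈ Icc a b :=
      ordConnected_Icc.uIcc_subset hks (hk_mem t (Ioo_subset_Icc_self ht)) (uIoc_subset_uIcc hx)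
    refine hasDerivAt_integral_moving_endpoint (a := a) (K := K) (M := M) hd ?_ ?_
      (sub_int hs (left_mem_Icc.2 hab) hks) ?_ ?_ ?_
    · filter_upwards [nhds] with t ht
      exact sub_int ht hks (hk_mem t (Ioo_subset_Icc_self ht))
    · filter_upwards [nhds] with t ht
      exact sub_int hs hks (hk_mem t (Ioo_subset_Icc_self ht))
    · filter_upwards [nhds] with t ht
      filter_upwards [hlip] with x hx hxm
      exact hx (mem ht hxm) t ht s hs
    · filter_upwards [nhds] with t ht x hx
      exact hf_bdd s (Ioo_subset_Icc_self hs) x (mem ht hx)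
    · by_cases hgood : k s ∈ Icc a b → ∀ u ∈ Ioo α β,
          HasDerivAt (fun y => ∫ z in a..y, f u z) (f u (k s)) (k s)
      · exact Or.inr (hgood hks s hs)
      · exact Or.inl (hnull hgood)
  filter_upwards [endpoint hg_lip hg_mem, endpoint hh_lip hh_mem] with s hgs hhs hs
  have nhds : ∀ᶠ t in 𝓝 s, t ∈ Ioo α β := Ioo_mem_nhds hs.1 hs.2
  have hsI := Ioo_subset_Icc_self hs
  have mem {x : ℝ} (hx : x ∈ uIoc (h s) (g s)) : x ∈ Icc a b :=
    ordConnected_Icc.uIcc_subset (hh_mem s hsI) (hg_mem s hsI) (uIoc_subset_uIcc hx)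
  have hmeas {t : ℝ} (ht : t ∈ Ioo α β) :
      AEStronglyMeasurable (f t) (volume.restrict (uIoc (h s) (g s))) :=
    (sub_int ht (hh_mem s hsI) (hg_mem s hsI)).def'.aestronglyMeasurable
  have hmeas' : AEStronglyMeasurable (f' s) (volume.restrict (uIoc (h s) (g s))) := by
    obtain ⟨u, -, hu, hlim⟩ := exists_seq_strictMono_tendsto' hs.1
    refine aestronglyMeasurable_of_tendsto_ae atTop
      (f := fun n x => (u n - s)⁻¹ * (f (u n) x - f s x))
      (fun n => ((hmeas ⟨(hu n).1, (hu n).2.trans hs.2⟩).sub (hmeas hs)).const_mul _) ?_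
    filter_upwards [ae_restrict_mem measurableSet_uIoc, ae_restrict_of_ae notMem_E₀] with x hx hxE
    exact (hasDerivAt_iff_tendsto_slope.1 (hf' s hs x ⟨mem hx, hxE⟩)).comp
      (tendsto_nhdsWithin_iff.2 ⟨hlim, Eventually.of_forall fun n => (hu n).2.ne⟩)
  have inner := (hasDerivAt_integral_of_dominated_loc_of_deriv_le (bound := fun _ => K) nhds
    (nhds.mono fun t ht => hmeas ht) (sub_int hs (hh_mem s hsI) (hg_mem s hsI)) hmeas'
    (Eventually.of_forall fun x hx t ht => hf'_bdd t ht x (mem hx)) intervalIntegrable_const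
    (by filter_upwards [notMem_E₀] with x hxE hx t ht using hf' t ht x ⟨mem hx, hxE⟩)).2
  have integral_eq : ∫ x in h s..g s, f' s x = ∫ x in Icc (h s) (g s) \ E₀, f' s x := by
    rw [intervalIntegral.integral_of_le (h_le s hsI), ← integral_Icc_eq_integral_Ioc,
      setIntegral_congr_set (sdiff_null_ae_eq_self hE₀_null)]
  rw [← integral_eq]
  refine (((hgs hs).sub (hhs hs)).add inner).congr_of_eventuallyEq ?_
  filter_upwards [nhds] with t ht
  have htI := Ioo_subset_Icc_self ht
  simp only [Pi.add_apply, Pi.sub_apply]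
  rw [← intervalIntegral.integral_add_adjacent_intervals
      (sub_int ht (hh_mem t htI) (hh_mem s hsI)) (sub_int ht (hh_mem s hsI) (hg_mem t htI)),
    ← intervalIntegral.integral_add_adjacent_intervals
      (sub_int ht (hh_mem s hsI) (hg_mem s hsI)) (sub_int ht (hg_mem s hsI) (hg_mem t htI)),
    intervalIntegral.integral_symm (h s) (h t)]
  ring
end

section
/- Let d ≥ 3 and let ρ be a bounded probability density on ℝ^d. For an integer k with 0 ≤ k ≤ d−2, define G(s) = ∫_{ℝ^d} ‖s−x‖₂^{−k} ρ(x) dx. Then for every s ∈ ℝ^d, G is Fréchet differentiable at s with gradient ∇G(s) = −k ∫_{ℝ^d} (s−x) ‖s−x‖₂^{−(k+2)} ρ(x) dx. -/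
open MeasureTheory

open Filter Topology Metric Set

section Pointwise

/-- A quantitative Lipschitz bound for `a ↦ a⁻ᵏ` on the positive reals. -/
lemma abs_one_div_pow_sub_le {a b : ℝ} (ha : 0 < a) (hb : 0 < b) (k : ℕ) :
    |1 / b ^ k - 1 / a ^ k| ≤ k * |b - a| * (1 / a ^ (k + 1) + 1 / b ^ (k + 1)) := by
  have key : ∀ {a b : ℝ}, 0 < a → a ≤ b →
      1 / a ^ k - 1 / b ^ k ≤ k * (b - a) * (1 / a ^ (k + 1)) := by
    intro a b ha hab
    have hb : 0 < b := ha.trans_le hab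
    have hbern := one_add_mul_le_pow (a := a / b - 1)
      (by linarith [div_pos ha hb]) k
    rw [add_sub_cancel, div_pow] at hbern
    have hle : (1 - a ^ k / b ^ k) / a ^ k ≤ (k * ((b - a) / a)) / a ^ k := by
      gcongr
      have h : (b - a) / b ≤ (b - a) / a := by
        gcongr
      have h' : (b - a) / b = 1 - a / b := by field_simp
      nlinarith [mul_le_mul_of_nonneg_left h (Nat.cast_nonneg (α := ℝ) k)]
    calc 1 / a ^ k - 1 / b ^ k = (1 - a ^ k / b ^ k) / a ^ k := by field_simp
      _ ≤ (k * ((b - a) / a)) / a ^ k := hle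
      _ = k * (b - a) * (1 / a ^ (k + 1)) := by
        field_simp
        ring
  have ha' : 0 < 1 / a ^ (k + 1) := by positivity
  have hb' : 0 < 1 / b ^ (k + 1) := by positivity
  rcases le_total a b with hab | hab
  · have hmono : 1 / b ^ k ≤ 1 / a ^ k := by gcongr
    rw [abs_sub_comm, abs_of_nonneg (sub_nonneg.2 hmono), abs_of_nonneg (sub_nonneg.2 hab)]
    refine (key ha hab).trans ?_
    have : 0 ≤ (k : ℝ) * (b - a) := mul_nonneg (Nat.cast_nonneg k) (sub_nonneg.2 hab)
    gcongr
    linarith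
  · have hmono : 1 / a ^ k ≤ 1 / b ^ k := by gcongr
    rw [abs_of_nonneg (sub_nonneg.2 hmono), abs_sub_comm b, abs_of_nonneg (sub_nonneg.2 hab)]
    refine (key hb hab).trans ?_
    have : 0 ≤ (k : ℝ) * (a - b) := mul_nonneg (Nat.cast_nonneg k) (sub_nonneg.2 hab)
    gcongr
    linarith

variable {E : Type*} [NormedAddCommGroup E] [InnerProductSpace ℝ E]

lemma hasFDerivAt_div_norm_sub_pow {s x : E} (hsx : s ≠ x) (c : ℝ) (k : ℕ) :
    HasFDerivAt (fun t => c / ‖t - x‖ ^ k)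
      (innerSL ℝ ((-(k : ℝ)) • (c / ‖s - x‖ ^ (k + 2)) • (s - x))) s := by
  have hpos : 0 < ‖s - x‖ := norm_pos_iff.2 (sub_ne_zero.2 hsx)
  have hsq := ((hasFDerivAt_id s).sub_const x).norm_sq
  have hsqrt := hsq.sqrt (pow_ne_zero 2 hpos.ne')
  simp only [id, Real.sqrt_sq (norm_nonneg _)] at hsqrt
  have hout : HasDerivAt (fun u : ℝ => c / u ^ k) (-(k : ℝ) * c / ‖s - x‖ ^ (k + 1)) ‖s - x‖ := by
    have h := (hasDerivAt_zpow (-(k : ℤ)) ‖s - x‖ (Or.inl hpos.ne')).const_mul c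
    convert! h using 1
    · ext u
      simp [div_eq_mul_inv]
    · rw [show (-(k : ℤ) - 1) = -((k + 1 : ℕ) : ℤ) by push_cast; ring, zpow_neg, zpow_natCast]
      push_cast
      field_simp
  refine (hout.comp_hasFDerivAt s hsqrt).congr_fderiv ?_
  ext v
  simp
  field_simp
  ring

/-- A bound on the first-order remainder of `t ↦ c / ‖t - x‖ ^ k` at `s`, relative to `‖t - s‖`. -/
lemma remainder_div_norm_sub_pow_le {s t x : E} (hsx : s ≠ x) (htx : t ≠ x) {c C : ℝ}
    (hc : 0 ≤ c) (hcC : c ≤ C) (k : ℕ) :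
    ‖t - s‖⁻¹ * |c / ‖t - x‖ ^ k - c / ‖s - x‖ ^ k
        - inner ℝ (t - s) ((-(k : ℝ)) • (c / ‖s - x‖ ^ (k + 2)) • (s - x))| ≤
      k * (2 + 2 ^ (k + 1)) * (c / ‖s - x‖ ^ (k + 1)) +
        k * C * (ball (0 : E) ‖t - s‖).indicator (fun y => 1 / ‖y‖ ^ (k + 1)) (t - x) := by
  have ha : 0 < ‖s - x‖ := norm_pos_iff.2 (sub_ne_zero.2 hsx)
  have hb : 0 < ‖t - x‖ := norm_pos_iff.2 (sub_ne_zero.2 htx)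
  have hC : 0 ≤ C := hc.trans hcC
  have htri : |‖t - x‖ - ‖s - x‖| ≤ ‖t - s‖ := by
    simpa using abs_norm_sub_norm_le (t - x) (s - x)
  have hdiff : |c / ‖t - x‖ ^ k - c / ‖s - x‖ ^ k| ≤
      ‖t - s‖ * (k * c * (1 / ‖s - x‖ ^ (k + 1) + 1 / ‖t - x‖ ^ (k + 1))) := by
    have h := abs_one_div_pow_sub_le ha hb k
    calc |c / ‖t - x‖ ^ k - c / ‖s - x‖ ^ k|
        = c * |1 / ‖t - x‖ ^ k - 1 / ‖s - x‖ ^ k| := by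
          rw [← abs_of_nonneg hc, ← abs_mul, abs_of_nonneg hc]
          ring_nf
      _ ≤ c * (k * ‖t - s‖ * (1 / ‖s - x‖ ^ (k + 1) + 1 / ‖t - x‖ ^ (k + 1))) := by
          gcongr
          refine h.trans ?_
          gcongr
      _ = _ := by ring
  have hlin : |inner ℝ (t - s) ((-(k : ℝ)) • (c / ‖s - x‖ ^ (k + 2)) • (s - x))| ≤
      ‖t - s‖ * (k * c * (1 / ‖s - x‖ ^ (k + 1))) := by
    refine (abs_real_inner_le_norm _ _).trans (le_of_eq ?_)
    rw [norm_smul, norm_smul, Real.norm_eq_abs, Real.norm_eq_abs, abs_neg, Nat.abs_cast,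
      abs_of_nonneg (div_nonneg hc (by positivity))]
    field_simp
    ring
  have hfar : c * (1 / ‖t - x‖ ^ (k + 1)) ≤ 2 ^ (k + 1) * (c / ‖s - x‖ ^ (k + 1)) +
      C * (ball (0 : E) ‖t - s‖).indicator (fun y => 1 / ‖y‖ ^ (k + 1)) (t - x) := by
    by_cases hmem : t - x ∈ ball (0 : E) ‖t - s‖
    · rw [indicator_of_mem hmem]
      have h1 : c * (1 / ‖t - x‖ ^ (k + 1)) ≤ C * (1 / ‖t - x‖ ^ (k + 1)) := by gcongr
      have h2 : 0 ≤ 2 ^ (k + 1) * (c / ‖s - x‖ ^ (k + 1)) := by positivity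
      linarith
    · rw [indicator_of_notMem hmem, mul_zero, add_zero]
      rw [mem_ball_zero_iff, not_lt] at hmem
      have hab : ‖s - x‖ / 2 ≤ ‖t - x‖ := by linarith [neg_abs_le (‖t - x‖ - ‖s - x‖)]
      calc c * (1 / ‖t - x‖ ^ (k + 1)) ≤ c * (1 / (‖s - x‖ / 2) ^ (k + 1)) := by gcongr
        _ = 2 ^ (k + 1) * (c / ‖s - x‖ ^ (k + 1)) := by
          rw [div_pow]
          field_simp
  have hsum := (abs_sub _ _).trans (add_le_add hdiff hlin)
  rw [← mul_add] at hsum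
  have hnn : 0 ≤ k * c * (1 / ‖s - x‖ ^ (k + 1) + 1 / ‖t - x‖ ^ (k + 1)) +
      k * c * (1 / ‖s - x‖ ^ (k + 1)) := by positivity
  have hk := mul_le_mul_of_nonneg_left hfar (Nat.cast_nonneg (α := ℝ) k)
  calc _ ≤ ‖t - s‖⁻¹ * (‖t - s‖ * _) := by gcongr
    _ ≤ _ := by
      rw [← mul_assoc]
      refine (mul_le_of_le_one_left hnn inv_mul_le_one).trans ?_
      have : c / ‖s - x‖ ^ (k + 1) = c * (1 / ‖s - x‖ ^ (k + 1)) := by ring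
      rw [this] at hk ⊢
      linarith

end Pointwise

section Integral

variable {E : Type*} [NormedAddCommGroup E] [InnerProductSpace ℝ E] [FiniteDimensional ℝ E]
  [MeasurableSpace E] [BorelSpace E] (μ : Measure E) [μ.IsAddHaarMeasure]

lemma integrable_indicator_ball_one_div_norm_pow {m : ℕ} (hm : m < Module.finrank ℝ E) (r : ℝ) :
    Integrable ((ball (0 : E) r).indicator fun y => 1 / ‖y‖ ^ m) μ := by
  rw [integrable_indicator_iff measurableSet_ball]
  refine integrableOn_ball_of_norm_le_rpow (C := 1) (α := m) (by lia) (by exact_mod_cast hm)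
    (ae_of_all _ fun y => ?_) (Measurable.aestronglyMeasurable (by fun_prop))
  simp [Real.rpow_neg]

variable {μ} {ρ : E → ℝ} {C : ℝ}

lemma integrable_div_norm_sub_pow (hρ : Integrable ρ μ) (hρ_meas : Measurable ρ)
    (hρ_nonneg : ∀ x, 0 ≤ ρ x) (hρ_bdd : ∀ᵐ x ∂μ, ρ x ≤ C) {m : ℕ}
    (hm : m < Module.finrank ℝ E) (t : E) :
    Integrable (fun x => ρ x / ‖t - x‖ ^ m) μ := by
  have hball := ((integrable_indicator_ball_one_div_norm_pow μ hm 1).comp_sub_left t).const_mul C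
  refine (hball.add hρ).mono' (Measurable.aestronglyMeasurable (by fun_prop)) ?_
  filter_upwards [hρ_bdd] with x hx
  rw [Real.norm_of_nonneg (div_nonneg (hρ_nonneg x) (by positivity)), Pi.add_apply]
  by_cases hmem : t - x ∈ ball (0 : E) 1
  · rw [indicator_of_mem hmem, mul_one_div]
    have : ρ x / ‖t - x‖ ^ m ≤ C / ‖t - x‖ ^ m := by gcongr
    linarith [hρ_nonneg x]
  · rw [indicator_of_notMem hmem, mul_zero, zero_add]
    rw [mem_ball_zero_iff, not_lt] at hmem
    exact div_le_self (hρ_nonneg x) (one_le_pow₀ hmem)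

lemma tendsto_integral_indicator_ball_one_div_norm_pow {m : ℕ} (hm : m < Module.finrank ℝ E)
    (s : E) :
    Tendsto (fun t => ∫ x, (ball (0 : E) ‖t - s‖).indicator (fun y => 1 / ‖y‖ ^ m) (t - x) ∂μ)
      (𝓝 s) (𝓝 0) := by
  have : Nontrivial E := Module.nontrivial_of_finrank_pos (R := ℝ) (by lia)
  have hnorm : Tendsto (fun t => ‖t - s‖) (𝓝 s) (𝓝 0) := by
    have : Continuous fun t => ‖t - s‖ := by fun_prop
    simpa using this.tendsto s
  simp_rw [fun t => integral_sub_left_eq_self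
    ((ball (0 : E) ‖t - s‖).indicator fun y => 1 / ‖y‖ ^ m) μ t]
  rw [← integral_zero E ℝ (μ := μ)]
  refine tendsto_integral_filter_of_dominated_convergence _ ?_ ?_
    (integrable_indicator_ball_one_div_norm_pow μ hm 1) ?_
  · refine Eventually.of_forall fun t => ?_
    exact (Measurable.indicator (by fun_prop) measurableSet_ball).aestronglyMeasurable
  · filter_upwards [hnorm.eventually (gt_mem_nhds one_pos)] with t ht
    refine ae_of_all _ fun y => ?_
    rw [Real.norm_of_nonneg (indicator_nonneg (fun y _ => by positivity) y)]
    exact indicator_le_indicator_of_subset (ball_subset_ball ht.le) (fun y => by positivity) y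
  · filter_upwards [μ.ae_ne 0] with y hy
    refine tendsto_const_nhds.congr' ?_
    filter_upwards [hnorm.eventually (gt_mem_nhds (norm_pos_iff.2 hy))] with t ht
    rw [indicator_of_notMem]
    simpa using ht.le

/-- The Riesz-type potential `t ↦ ∫ ρ(x) ‖t - x‖⁻ᵏ dμ(x)` of a bounded integrable density is
differentiable when `k + 1` is less than the dimension. -/
theorem hasGradientAt_integral_div_norm_sub_pow (hρ : Integrable ρ μ) (hρ_meas : Measurable ρ)
    (hρ_nonneg : ∀ x, 0 ≤ ρ x) (hρ_bdd : ∀ᵐ x ∂μ, ρ x ≤ C) {k : ℕ}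
    (hk : k + 1 < Module.finrank ℝ E) (s : E) :
    HasGradientAt (fun t => ∫ x, ρ x / ‖t - x‖ ^ k ∂μ)
      ((-(k : ℝ)) • ∫ x, (ρ x / ‖s - x‖ ^ (k + 2)) • (s - x) ∂μ) s := by
  have : Nontrivial E := Module.nontrivial_of_finrank_pos (R := ℝ) (by lia)
  have hint {m : ℕ} (hm : m < Module.finrank ℝ E) (t : E) :=
    integrable_div_norm_sub_pow hρ hρ_meas hρ_nonneg hρ_bdd hm t
  have hgrad_int : Integrable (fun x => (-(k : ℝ)) • (ρ x / ‖s - x‖ ^ (k + 2)) • (s - x)) μ := by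
    refine Integrable.smul _ ((hint hk s).mono' (by fun_prop) ?_)
    filter_upwards [μ.ae_ne s] with x hx
    have hpos : 0 < ‖s - x‖ := norm_pos_iff.2 (sub_ne_zero.2 hx.symm)
    rw [norm_smul, Real.norm_of_nonneg (div_nonneg (hρ_nonneg x) (by positivity))]
    refine le_of_eq ?_
    field_simp
    ring
  set R : E → E → ℝ := fun t x => ρ x / ‖t - x‖ ^ k - ρ x / ‖s - x‖ ^ k
    - inner ℝ (t - s) ((-(k : ℝ)) • (ρ x / ‖s - x‖ ^ (k + 2)) • (s - x)) with hR
  have hR_int (t : E) : Integrable (R t) μ :=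
    ((hint (by lia) t).sub (hint (by lia) s)).sub (hgrad_int.const_inner _)
  set V : E → E → ℝ := fun t x => ‖t - s‖⁻¹ * |R t x| with hV
  have hV_int (t : E) : Integrable (V t) μ := (hR_int t).abs.const_mul _
  have hV_nonneg (t x : E) : 0 ≤ V t x := by positivity
  set g : E → ℝ := fun x => k * (2 + 2 ^ (k + 1)) * (ρ x / ‖s - x‖ ^ (k + 1))
  have hg_int : Integrable g μ := (hint hk s).const_mul _
  have hg_nonneg (x : E) : 0 ≤ g x :=
    mul_nonneg (by positivity) (div_nonneg (hρ_nonneg x) (by positivity))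
  set e : E → E → ℝ := fun t x =>
    k * C * (ball (0 : E) ‖t - s‖).indicator (fun y => 1 / ‖y‖ ^ (k + 1)) (t - x) with he
  have hV_le (t : E) : ∀ᵐ x ∂μ, V t x ≤ g x + e t x := by
    filter_upwards [hρ_bdd, μ.ae_ne s, μ.ae_ne t] with x hx hxs hxt
    exact remainder_div_norm_sub_pow_le hxs.symm hxt.symm (hρ_nonneg x) hx k
  have he_int (t : E) : Integrable (e t) μ := by
    have h := ((integrable_indicator_ball_one_div_norm_pow μ hk ‖t - s‖).comp_sub_left t)
    exact h.const_mul _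
  have he_lim : Tendsto (fun t => ∫ x, e t x ∂μ) (𝓝 s) (𝓝 0) := by
    simp_rw [he, integral_const_mul]
    simpa using (tendsto_integral_indicator_ball_one_div_norm_pow (μ := μ) hk s).const_mul (k * C)
  have hmin_lim : Tendsto (fun t => ∫ x, min (V t x) (g x) ∂μ) (𝓝 s) (𝓝 0) := by
    rw [← integral_zero E ℝ (μ := μ)]
    refine tendsto_integral_filter_of_dominated_convergence g
      (Eventually.of_forall fun t => ((hV_int t).inf hg_int).aestronglyMeasurable)
      (Eventually.of_forall fun t => ae_of_all _ fun x => ?_) hg_int ?_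
    · rw [Real.norm_of_nonneg (le_min (hV_nonneg t x) (hg_nonneg x))]
      exact min_le_right _ _
    · filter_upwards [μ.ae_ne s] with x hx
      have h := hasFDerivAt_iff_tendsto.1 (hasFDerivAt_div_norm_sub_pow hx.symm (ρ x) k)
      refine squeeze_zero (fun t => le_min (hV_nonneg t x) (hg_nonneg x))
        (fun t => min_le_left _ _) (h.congr fun t => ?_)
      simp only [hV, hR, innerSL_apply_apply, Real.norm_eq_abs]
      rw [real_inner_comm]
  rw [hasGradientAt_iff_hasFDerivAt, hasFDerivAt_iff_tendsto]
  refine squeeze_zero (fun t => by positivity) (fun t => ?_)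
    (by simpa using hmin_lim.add he_lim)
  have hremainder : (∫ x, ρ x / ‖t - x‖ ^ k ∂μ) - (∫ x, ρ x / ‖s - x‖ ^ k ∂μ)
      - InnerProductSpace.toDual ℝ E
        ((-(k : ℝ)) • ∫ x, (ρ x / ‖s - x‖ ^ (k + 2)) • (s - x) ∂μ) (t - s) = ∫ x, R t x ∂μ := by
    have hsub : Integrable (fun x => ρ x / ‖t - x‖ ^ k - ρ x / ‖s - x‖ ^ k) μ :=
      (hint (by lia) t).sub (hint (by lia) s)
    rw [InnerProductSpace.toDual_apply_apply, real_inner_comm, ← integral_smul,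
      ← integral_inner hgrad_int, ← integral_sub (hint (by lia) t) (hint (by lia) s),
      ← integral_sub hsub (hgrad_int.const_inner _)]
  rw [hremainder]
  calc ‖t - s‖⁻¹ * ‖∫ x, R t x ∂μ‖ ≤ ‖t - s‖⁻¹ * ∫ x, |R t x| ∂μ := by
        gcongr
        exact norm_integral_le_integral_norm _
    _ = ∫ x, V t x ∂μ := (integral_const_mul _ _).symm
    _ ≤ ∫ x, (min (V t x) (g x) + e t x) ∂μ := by
        refine integral_mono_ae (hV_int t) (((hV_int t).inf hg_int).add (he_int t)) ?_
        filter_upwards [hV_le t, hρ_bdd] with x hx hxC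
        have hC : 0 ≤ C := (hρ_nonneg x).trans hxC
        have he_nonneg : 0 ≤ e t x :=
          mul_nonneg (by positivity) (indicator_nonneg (fun y _ => by positivity) _)
        rw [min_add, le_min_iff]
        exact ⟨by linarith, hx⟩
    _ = _ := integral_add ((hV_int t).inf hg_int) (he_int t)

end Integral

/-- **Lemma 2.** For `d ≥ 3`, a bounded probability density `ρ` on `ℝ^d` and `0 ≤ k ≤ d - 2`,
the function `G(s) = ∫ ‖s - x‖₂⁻ᵏ ρ(x) dx` is Fréchet differentiable at every `s`, with
gradient `∇G(s) = -k ∫ (s - x) ‖s - x‖₂^{-(k+2)} ρ(x) dx`. -/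
theorem hasGradientAt_integral_inv_norm_pow
    (d : ℕ) (hd : 3 ≤ d)
    (ρ : EuclideanSpace ℝ (Fin d) → ℝ)
    (hρ_meas : Measurable ρ)
    (hρ_nonneg : ∀ x, 0 ≤ ρ x)
    (C : ℝ) (hρ_bdd : ∀ᵐ x ∂volume, ρ x ≤ C)
    (hρ_int : ∫ x, ρ x ∂volume = 1)
    (k : ℕ) (hk : k ≤ d - 2)
    (s : EuclideanSpace ℝ (Fin d)) :
    HasGradientAt (fun t => ∫ x, ρ x / ‖t - x‖ ^ k ∂volume)
      ((-(k : ℝ)) • ∫ x, (ρ x / ‖s - x‖ ^ (k + 2)) • (s - x) ∂volume) s := by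
  refine hasGradientAt_integral_div_norm_sub_pow
    (Integrable.of_integral_ne_zero (by simp [hρ_int])) hρ_meas hρ_nonneg hρ_bdd ?_ s
  rw [finrank_euclideanSpace_fin]
  lia
end

section
/- Let d ≥ 3 and let ρ be a bounded probability density on ℝ^d. For an integer k with 0 ≤ k ≤ d−3, define G(s) = ∫_{ℝ^d} ‖s−x‖₂^{−k} ρ(x) dx. Then for every s ∈ ℝ^d, the Hessian (second Fréchet derivative) of G at s exists and equals D_s G(s) = −k ∫_{ℝ^d} [ I_d / ‖s−x‖₂^{k+2} − (k+2) (s−x)(s−x)^T / ‖s−x‖₂^{k+4} ] ρ(x) dx, where I_d is the d × d identity matrix. -/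
open MeasureTheory

open Filter Topology Metric
open scoped ENNReal

section Potential

variable {E : Type*} [NormedAddCommGroup E] [NormedSpace ℝ E] [FiniteDimensional ℝ E]
  [MeasurableSpace E] [BorelSpace E] {μ ν : Measure E} [μ.IsAddHaarMeasure]

theorem setLIntegral_ball_inv_norm_pow_ne_top {m : ℕ} (hm : m < Module.finrank ℝ E) (r : ℝ) :
    ∫⁻ y in ball (0 : E) r, ENNReal.ofReal (‖y‖ ^ m)⁻¹ ∂μ ≠ ∞ := by
  have : Nontrivial E := Module.nontrivial_of_finrank_pos (R := ℝ) (by omega)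
  have h : IntegrableOn (fun y : E ↦ (‖y‖ ^ m)⁻¹) (ball 0 r) μ := by
    rw [integrableOn_fun_norm_addHaar μ (f := fun t : ℝ ↦ (t ^ m)⁻¹)]
    have hc : IntegrableOn (fun t : ℝ ↦ t ^ (Module.finrank ℝ E - 1 - m)) (Set.Ioo 0 r) :=
      ((continuous_pow _).continuousOn.integrableOn_Icc (a := 0) (b := r)).mono_set
        Set.Ioo_subset_Icc_self
    refine hc.congr_fun (fun t ht ↦ ?_) measurableSet_Ioo
    have ht0 : t ≠ 0 := ht.1.ne'
    simp only [smul_eq_mul]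
    rw [pow_sub₀ _ ht0 (by omega)]
  exact (hasFiniteIntegral_iff_ofReal (ae_of_all _ fun _ ↦ by positivity)).1 h.2 |>.ne

theorem setLIntegral_ball_inv_norm_sub_pow_le
    {C : ℝ≥0∞} (hν : ν ≤ C • μ) (m : ℕ) (u : E) (r : ℝ) :
    ∫⁻ x in ball u r, ENNReal.ofReal (‖u - x‖ ^ m)⁻¹ ∂ν ≤
      C * ∫⁻ y in ball (0 : E) r, ENNReal.ofReal (‖y‖ ^ m)⁻¹ ∂μ := by
  calc
    _ ≤ ∫⁻ x in ball u r, ENNReal.ofReal (‖u - x‖ ^ m)⁻¹ ∂(C • μ) :=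
      lintegral_mono' (Measure.restrict_mono_measure hν _) le_rfl
    _ = C * ∫⁻ x in ball u r, ENNReal.ofReal (‖u - x‖ ^ m)⁻¹ ∂μ := by
      rw [Measure.restrict_smul, lintegral_smul_measure, smul_eq_mul]
    _ = _ := by
      rw [← lintegral_indicator measurableSet_ball, ← lintegral_indicator measurableSet_ball,
        ← lintegral_sub_left_eq_self _ u]
      congr 2 with x
      simp [Set.indicator, dist_eq_norm]

theorem tendsto_setLIntegral_ball_inv_norm_pow {m : ℕ} (hm : m < Module.finrank ℝ E) :
    Tendsto (fun r ↦ ∫⁻ y in ball (0 : E) r, ENNReal.ofReal (‖y‖ ^ m)⁻¹ ∂μ) (𝓝[>] 0) (𝓝 0) := by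
  have : Nontrivial E := Module.nontrivial_of_finrank_pos (R := ℝ) (by omega)
  have h1 : Tendsto (fun r ↦ ∫⁻ y in ball (0 : E) r, ENNReal.ofReal (‖y‖ ^ m)⁻¹
      ∂(μ.restrict (ball 0 1))) (𝓝[>] 0) (𝓝 0) := by
    refine tendsto_setLIntegral_zero (setLIntegral_ball_inv_norm_pow_ne_top hm 1) ?_
    have h2 : Tendsto (fun r : ℝ ↦ ENNReal.ofReal (r ^ Module.finrank ℝ E) * μ (ball 0 1))
        (𝓝[>] 0) (𝓝 0) := by
      have h3 : Tendsto (fun r : ℝ ↦ ENNReal.ofReal (r ^ Module.finrank ℝ E)) (𝓝[>] 0) (𝓝 0) := by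
        have : Continuous (fun r : ℝ ↦ ENNReal.ofReal (r ^ Module.finrank ℝ E)) :=
          ENNReal.continuous_ofReal.comp (continuous_pow _)
        simpa [show Module.finrank ℝ E ≠ 0 by omega] using
          (this.tendsto 0).mono_left nhdsWithin_le_nhds
      simpa using ENNReal.Tendsto.mul_const h3 (Or.inr measure_ball_lt_top.ne)
    refine tendsto_of_tendsto_of_tendsto_of_le_of_le' tendsto_const_nhds h2
      (Eventually.of_forall fun _ ↦ zero_le) ?_
    filter_upwards [self_mem_nhdsWithin] with r hr
    rw [← Measure.addHaar_ball _ _ (le_of_lt hr)]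
    exact Measure.restrict_apply_le _ _
  refine h1.congr' ?_
  filter_upwards [Ioo_mem_nhdsGT (zero_lt_one' ℝ)] with r hr
  rw [Measure.restrict_restrict measurableSet_ball,
    Set.inter_eq_left.2 (ball_subset_ball hr.2.le)]

theorem lintegral_inv_norm_sub_pow_ne_top [IsFiniteMeasure ν] {C : ℝ≥0∞} (hC : C ≠ ∞)
    (hν : ν ≤ C • μ) {m : ℕ} (hm : m < Module.finrank ℝ E) (u : E) :
    ∫⁻ x, ENNReal.ofReal (‖u - x‖ ^ m)⁻¹ ∂ν ≠ ∞ := by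
  rw [← lintegral_add_compl _ (measurableSet_ball (x := u) (ε := 1))]
  refine ENNReal.add_ne_top.2 ⟨ne_top_of_le_ne_top (ENNReal.mul_ne_top hC
    (setLIntegral_ball_inv_norm_pow_ne_top (μ := μ) hm 1))
    (setLIntegral_ball_inv_norm_sub_pow_le hν m u 1), ?_⟩
  refine ne_top_of_le_ne_top (measure_ne_top ν (ball u 1)ᶜ) ?_
  rw [← setLIntegral_one]
  refine setLIntegral_mono measurable_const fun x hx ↦ ?_
  rw [Set.mem_compl_iff, mem_ball', not_lt, dist_eq_norm] at hx
  exact ENNReal.ofReal_le_one.2 (inv_le_one_of_one_le₀ (one_le_pow₀ hx))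

/-- Dominated convergence where the dominating function has a singularity moving with the
parameter. -/
theorem tendsto_lintegral_enorm_of_le_inv_norm_sub_pow {F : Type*} [NormedAddCommGroup F]
    [IsFiniteMeasure ν] {C : ℝ≥0∞} (hC : C ≠ ∞)
    (hν : ν ≤ C • μ) {m : ℕ} (hm : m < Module.finrank ℝ E) {s : E} {R : E → E → F}
    (hR : ∀ u, AEStronglyMeasurable (R u) ν) {A : ℝ≥0∞} (hA : A ≠ ∞)
    (hle : ∀ u x, ‖R u x‖ₑ ≤
      A * (ENNReal.ofReal (‖s - x‖ ^ m)⁻¹ + ENNReal.ofReal (‖u - x‖ ^ m)⁻¹))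
    (hlim : ∀ᵐ x ∂ν, Tendsto (fun u ↦ R u x) (𝓝 s) (𝓝 0)) :
    Tendsto (fun u ↦ ∫⁻ x, ‖R u x‖ₑ ∂ν) (𝓝 s) (𝓝 0) := by
  rw [ENNReal.tendsto_nhds_zero]
  intro ε hε
  set J : ℝ → ℝ≥0∞ := fun r ↦ C * ∫⁻ y in ball (0 : E) r, ENNReal.ofReal (‖y‖ ^ m)⁻¹ ∂μ
  have hJ0 : Tendsto (fun r ↦ A * (J r + J r)) (𝓝[>] 0) (𝓝 0) := by
    have h : Tendsto J (𝓝[>] 0) (𝓝 0) := by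
      simpa using ENNReal.Tendsto.const_mul
        (tendsto_setLIntegral_ball_inv_norm_pow (μ := μ) hm) (Or.inr hC)
    simpa using ENNReal.Tendsto.const_mul (h.add h) (Or.inr hA)
  obtain ⟨r, hr, hr0⟩ := ((ENNReal.tendsto_nhds_zero.1 hJ0 (ε / 2) (ENNReal.half_pos hε.ne')).and
    self_mem_nhdsWithin).exists
  have hr0 : 0 < r := hr0
  have hfar : Tendsto (fun u ↦ ∫⁻ x, (ball u (r / 2))ᶜ.indicator (fun x ↦ ‖R u x‖ₑ) x ∂ν)
      (𝓝 s) (𝓝 0) := by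
    rw [← lintegral_zero (μ := ν)]
    refine tendsto_lintegral_filter_of_dominated_convergence'
      (fun x ↦ A * (ENNReal.ofReal (‖s - x‖ ^ m)⁻¹ + ENNReal.ofReal ((r / 2) ^ m)⁻¹))
      (Eventually.of_forall fun u ↦ (hR u).enorm.indicator measurableSet_ball.compl)
      (Eventually.of_forall fun u ↦ ae_of_all _ fun x ↦ ?_) ?_ ?_
    · by_cases hx : x ∈ ball u (r / 2)
      · simp [hx]
      · rw [Set.indicator_of_mem (by exact hx)]
        refine (hle u x).trans ?_
        rw [mem_ball', not_lt, dist_eq_norm] at hx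
        gcongr
    · rw [lintegral_const_mul _ (by fun_prop), lintegral_add_right _ measurable_const,
        lintegral_const]
      exact ENNReal.mul_ne_top hA (ENNReal.add_ne_top.2
        ⟨lintegral_inv_norm_sub_pow_ne_top hC hν hm s,
          ENNReal.mul_ne_top ENNReal.ofReal_ne_top (measure_ne_top _ _)⟩)
    · filter_upwards [hlim] with x hx
      refine tendsto_of_tendsto_of_tendsto_of_le_of_le tendsto_const_nhds
        (by simpa using hx.enorm) (fun _ ↦ zero_le) fun u ↦ ?_
      exact Set.indicator_le_self _ _ _
  filter_upwards [ENNReal.tendsto_nhds_zero.1 hfar (ε / 2) (ENNReal.half_pos hε.ne'),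
    ball_mem_nhds s (half_pos hr0)] with u hu hus
  rw [← lintegral_add_compl _ (measurableSet_ball (x := u) (ε := r / 2)),
    ← ENNReal.add_halves ε]
  rw [lintegral_indicator measurableSet_ball.compl] at hu
  refine add_le_add (le_trans ?_ hr) hu
  calc
    _ ≤ ∫⁻ x in ball u (r / 2),
        A * (ENNReal.ofReal (‖s - x‖ ^ m)⁻¹ + ENNReal.ofReal (‖u - x‖ ^ m)⁻¹) ∂ν :=
      lintegral_mono fun x ↦ hle u x
    _ = A * (∫⁻ x in ball u (r / 2), ENNReal.ofReal (‖s - x‖ ^ m)⁻¹ ∂ν +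
        ∫⁻ x in ball u (r / 2), ENNReal.ofReal (‖u - x‖ ^ m)⁻¹ ∂ν) := by
      rw [lintegral_const_mul _ (by fun_prop), lintegral_add_left (by fun_prop)]
    _ ≤ A * (J r + J r) := by
      gcongr
      · refine le_trans (lintegral_mono_set (ball_subset_ball' ?_))
          (setLIntegral_ball_inv_norm_sub_pow_le hν m s r)
        rw [mem_ball] at hus
        linarith
      · exact le_trans (lintegral_mono_set (ball_subset_ball (by linarith)))
          (setLIntegral_ball_inv_norm_sub_pow_le hν m u r)

theorem integrable_of_norm_le_inv_norm_sub_pow {F : Type*} [NormedAddCommGroup F]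
    [IsFiniteMeasure ν] {C : ℝ≥0∞} (hC : C ≠ ∞) (hν : ν ≤ C • μ)
    {m : ℕ} (hm : m < Module.finrank ℝ E) {u : E} {f : E → F} (hf : AEStronglyMeasurable f ν)
    {M : ℝ} (hle : ∀ x, ‖f x‖ ≤ M * (‖u - x‖ ^ m)⁻¹) : Integrable f ν := by
  have h : Integrable (fun x ↦ (‖u - x‖ ^ m)⁻¹) ν := by
    refine ⟨by fun_prop, (hasFiniteIntegral_iff_ofReal (ae_of_all _ fun _ ↦ by positivity)).2 ?_⟩
    exact (lintegral_inv_norm_sub_pow_ne_top hC hν hm u).lt_top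
  exact (h.const_mul M).mono' hf (ae_of_all _ hle)

/-- Differentiation under the integral sign for convolutions with a weakly singular kernel. -/
theorem hasFDerivAt_integral_sub_of_singular {F : Type*} [NormedAddCommGroup F] [NormedSpace ℝ F]
    [CompleteSpace F] [IsFiniteMeasure ν] {C : ℝ≥0∞} (hC : C ≠ ∞) (hν : ν ≤ C • μ)
    {m : ℕ} (hm : m + 1 < Module.finrank ℝ E)
    {K : E → F} {K' : E → E →L[ℝ] F} (hK : StronglyMeasurable K) (hK' : StronglyMeasurable K')
    (hderiv : ∀ y, y ≠ 0 → HasFDerivAt K (K' y) y) {M : ℝ} (hM : 0 ≤ M)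
    (hK_le : ∀ y, ‖K y‖ ≤ (‖y‖ ^ m)⁻¹)
    (hK'_le : ∀ y, ‖K' y‖ ≤ M * (‖y‖ ^ (m + 1))⁻¹)
    (hlip : ∀ y z, ‖K y - K z‖ ≤ M * ‖y - z‖ * ((‖y‖ ^ (m + 1))⁻¹ + (‖z‖ ^ (m + 1))⁻¹)) (s : E) :
    HasFDerivAt (fun u ↦ ∫ x, K (u - x) ∂ν) (∫ x, K' (s - x) ∂ν) s := by
  have : Nontrivial E := Module.nontrivial_of_finrank_pos (R := ℝ) (by omega)
  have hKm (u : E) : StronglyMeasurable fun x ↦ K (u - x) :=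
    hK.comp_measurable (measurable_const.sub measurable_id)
  have hK'm (u : E) : StronglyMeasurable fun x ↦ K' (u - x) :=
    hK'.comp_measurable (measurable_const.sub measurable_id)
  have hKi (u : E) : Integrable (fun x ↦ K (u - x)) ν :=
    integrable_of_norm_le_inv_norm_sub_pow hC hν (m := m) (by omega) (M := 1) (u := u)
      (hKm u).aestronglyMeasurable fun x ↦ by simpa using hK_le (u - x)
  have hK'i : Integrable (fun x ↦ K' (s - x)) ν :=
    integrable_of_norm_le_inv_norm_sub_pow hC hν hm (hK'm s).aestronglyMeasurable
      fun x ↦ hK'_le (s - x)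
  set R : E → E → F := fun u x ↦ ‖u - s‖⁻¹ • (K (u - x) - K (s - x) - K' (s - x) (u - s)) with hR
  have hRint (u : E) : ∫ x, R u x ∂ν = ‖u - s‖⁻¹ •
      ((∫ x, K (u - x) ∂ν) - (∫ x, K (s - x) ∂ν) - (∫ x, K' (s - x) ∂ν) (u - s)) := by
    have hsub : Integrable (fun x ↦ K (u - x) - K (s - x)) ν := (hKi u).sub (hKi s)
    rw [hR, integral_smul, integral_sub hsub (hK'i.apply_continuousLinearMap _),
      integral_sub (hKi u) (hKi s), ContinuousLinearMap.integral_apply hK'i]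
  have hRle (u x : E) : ‖R u x‖ ≤
      2 * M * ((‖s - x‖ ^ (m + 1))⁻¹ + (‖u - x‖ ^ (m + 1))⁻¹) := by
    have h1 := hlip (u - x) (s - x)
    have h2 := (K' (s - x)).le_of_opNorm_le (hK'_le _) (u - s)
    rw [sub_sub_sub_cancel_right] at h1
    rw [hR, norm_smul, norm_inv, norm_norm]
    rcases eq_or_ne u s with rfl | hus
    · simp only [sub_self, norm_zero, inv_zero, zero_mul]
      positivity
    · have hpos : 0 < ‖u - s‖ := norm_pos_iff.2 (sub_ne_zero.2 hus)
      rw [inv_mul_le_iff₀ hpos]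
      refine (norm_sub_le _ _).trans ((add_le_add h1 h2).trans ?_)
      have : 0 ≤ M * ‖u - s‖ * (‖u - x‖ ^ (m + 1))⁻¹ := by positivity
      linarith
  have hlimR : Tendsto (fun u ↦ ∫⁻ x, ‖R u x‖ₑ ∂ν) (𝓝 s) (𝓝 0) := by
    refine tendsto_lintegral_enorm_of_le_inv_norm_sub_pow hC hν hm (fun u ↦ ?_)
      (A := ENNReal.ofReal (2 * M)) ENNReal.ofReal_ne_top (fun u x ↦ ?_) ?_
    · exact ((((hKi u).sub (hKi s)).sub (hK'i.apply_continuousLinearMap _)).smul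
        (‖u - s‖⁻¹)).aestronglyMeasurable
    · rw [← ENNReal.ofReal_add (by positivity) (by positivity),
        ← ENNReal.ofReal_mul (by positivity), ← ofReal_norm]
      exact ENNReal.ofReal_le_ofReal (hRle u x)
    · have hne : ∀ᵐ x ∂ν, x ≠ s := by
        refine (Measure.absolutelyContinuous_of_le_smul hν).ae_le ?_
        exact compl_mem_ae_iff.2 (measure_singleton s)
      filter_upwards [hne] with x hx
      have h := (hderiv (s - x) (sub_ne_zero.2 hx.symm)).comp s ((hasFDerivAt_id s).sub_const x)
      have h' := hasFDerivAt_iff_tendsto.1 h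
      rw [tendsto_zero_iff_norm_tendsto_zero]
      simpa [hR, norm_smul] using h'
  rw [hasFDerivAt_iff_tendsto]
  have h0 : Tendsto (fun u ↦ ∫ x, R u x ∂ν) (𝓝 s) (𝓝 0) := by
    rw [tendsto_zero_iff_enorm_tendsto_zero]
    exact tendsto_of_tendsto_of_tendsto_of_le_of_le tendsto_const_nhds hlimR
      (fun _ ↦ zero_le) fun u ↦ enorm_integral_le_lintegral_enorm _
  simpa [hRint, norm_smul] using h0.norm

end Potential

section Kernel

theorem abs_inv_pow_sub_inv_pow_le {a b : ℝ} (ha : 0 ≤ a) (hb : 0 ≤ b) (k : ℕ) :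
    |(a ^ k)⁻¹ - (b ^ k)⁻¹| ≤ k * |a - b| * ((a ^ (k + 1))⁻¹ + (b ^ (k + 1))⁻¹) := by
  wlog hab : a ≤ b generalizing a b
  · rw [abs_sub_comm, abs_sub_comm a, add_comm]
    exact this hb ha (le_of_not_ge hab)
  rcases Nat.eq_zero_or_pos k with rfl | hk
  · simp
  have hk1 : (1 : ℝ) ≤ k := by exact_mod_cast hk
  rcases ha.eq_or_lt with rfl | ha
  · rcases hb.eq_or_lt with rfl | hb
    · simp
    · rw [zero_pow hk.ne', zero_pow (by omega), inv_zero, zero_sub, zero_sub, abs_neg, abs_neg,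
        abs_of_pos hb, abs_of_pos (by positivity), zero_add, pow_succ, mul_inv,
        show (k : ℝ) * b * ((b ^ k)⁻¹ * b⁻¹) = k * (b ^ k)⁻¹ by field_simp]
      exact le_mul_of_one_le_left (by positivity) hk1
  · have hb : 0 < b := ha.trans_le hab
    have h := abs_pow_sub_pow_le a⁻¹ b⁻¹ k
    have hinv : b⁻¹ ≤ a⁻¹ := inv_anti₀ ha hab
    rw [abs_of_pos (inv_pos.2 ha), abs_of_pos (inv_pos.2 hb), max_eq_left hinv, inv_pow,
      inv_pow] at h
    have hsub : |a⁻¹ - b⁻¹| ≤ |a - b| * (a⁻¹ * a⁻¹) := by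
      rw [inv_sub_inv ha.ne' hb.ne', abs_div, abs_sub_comm, abs_of_pos (mul_pos ha hb),
        div_eq_mul_inv, mul_inv]
      gcongr
    calc
      _ ≤ |a⁻¹ - b⁻¹| * k * a⁻¹ ^ (k - 1) := h
      _ ≤ |a - b| * (a⁻¹ * a⁻¹) * k * a⁻¹ ^ (k - 1) := by gcongr
      _ = k * |a - b| * (a ^ (k + 1))⁻¹ := by
        obtain ⟨j, rfl⟩ : ∃ j, k = j + 1 := ⟨k - 1, by omega⟩
        rw [← inv_pow, Nat.add_sub_cancel]
        ring
      _ ≤ _ := by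
        gcongr
        exact le_add_of_nonneg_right (by positivity)

theorem norm_mul_inv_norm_pow_succ_le {E : Type*} [SeminormedAddCommGroup E] (y : E) (n : ℕ) :
    (‖y‖ ^ (n + 1))⁻¹ * ‖y‖ ≤ (‖y‖ ^ n)⁻¹ := by
  rcases (norm_nonneg y).eq_or_lt with h | h
  · rw [← h]
    simp
  · rw [pow_succ, mul_inv, inv_mul_cancel_right₀ h.ne']

theorem norm_inv_norm_pow_smul_sub_le {E : Type*} [NormedAddCommGroup E] [NormedSpace ℝ E]
    (n : ℕ) (y z : E) :
    ‖(‖y‖ ^ n)⁻¹ • y - (‖z‖ ^ n)⁻¹ • z‖ ≤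
      (n + 1) * ‖y - z‖ * ((‖y‖ ^ n)⁻¹ + (‖z‖ ^ n)⁻¹) := by
  wlog hyz : ‖z‖ ≤ ‖y‖ generalizing y z
  · rw [norm_sub_rev, norm_sub_rev y, add_comm (‖y‖ ^ n)⁻¹]
    exact this z y (le_of_not_ge hyz)
  rcases eq_or_ne z 0 with rfl | hz
  · rw [smul_zero, sub_zero, sub_zero, norm_smul, norm_inv, norm_pow, norm_norm]
    have h1 : 0 ≤ n * ‖y‖ * (‖y‖ ^ n)⁻¹ := by positivity
    have h2 : 0 ≤ (n + 1) * ‖y‖ * (‖(0 : E)‖ ^ n)⁻¹ := by positivity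
    linarith
  have ha : 0 < ‖z‖ := norm_pos_iff.2 hz
  have hb : 0 < ‖y‖ := ha.trans_le hyz
  have h := abs_pow_sub_pow_le ‖y‖⁻¹ ‖z‖⁻¹ n
  rw [abs_of_pos (inv_pos.2 ha), abs_of_pos (inv_pos.2 hb), max_eq_right (inv_anti₀ ha hyz),
    inv_pow, inv_pow, inv_sub_inv hb.ne' ha.ne', abs_div, abs_of_pos (mul_pos hb ha),
    abs_sub_comm ‖z‖] at h
  have h1 : |(‖y‖ ^ n)⁻¹ - (‖z‖ ^ n)⁻¹| * ‖y‖ ≤ n * ‖y - z‖ * (‖z‖ ^ n)⁻¹ := by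
    calc
      _ ≤ |‖y‖ - ‖z‖| / (‖y‖ * ‖z‖) * n * ‖z‖⁻¹ ^ (n - 1) * ‖y‖ := by gcongr
      _ = n * |‖y‖ - ‖z‖| * (‖z‖ ^ n)⁻¹ := by
        rcases n with _ | j
        · simp
        · rw [← inv_pow, Nat.add_sub_cancel, pow_succ]
          field_simp
      _ ≤ _ := by
        gcongr
        exact abs_norm_sub_norm_le y z
  calc
    _ = ‖(‖z‖ ^ n)⁻¹ • (y - z) + ((‖y‖ ^ n)⁻¹ - (‖z‖ ^ n)⁻¹) • y‖ := by
      congr 1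
      module
    _ ≤ (‖z‖ ^ n)⁻¹ * ‖y - z‖ + |(‖y‖ ^ n)⁻¹ - (‖z‖ ^ n)⁻¹| * ‖y‖ := by
      refine (norm_add_le _ _).trans_eq ?_
      rw [norm_smul, norm_smul, norm_inv, norm_pow, norm_norm, Real.norm_eq_abs]
    _ ≤ (‖z‖ ^ n)⁻¹ * ‖y - z‖ + n * ‖y - z‖ * (‖z‖ ^ n)⁻¹ := by gcongr
    _ = (n + 1) * ‖y - z‖ * (‖z‖ ^ n)⁻¹ := by ring
    _ ≤ _ := by
      gcongr
      exact le_add_of_nonneg_left (by positivity)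

variable {E : Type*} [NormedAddCommGroup E] [InnerProductSpace ℝ E]

theorem hasFDerivAt_inv_norm_pow (k : ℕ) {y : E} (hy : y ≠ 0) :
    HasFDerivAt (fun y : E ↦ (‖y‖ ^ k)⁻¹) ((-k * (‖y‖ ^ (k + 2))⁻¹ : ℝ) • innerSL ℝ y) y := by
  have hy0 : ‖y‖ ≠ 0 := norm_ne_zero_iff.2 hy
  have h1 : HasFDerivAt (fun y : E ↦ ‖y‖) (‖y‖⁻¹ • innerSL ℝ y) y := by
    have h := (hasStrictFDerivAt_norm_sq y).hasFDerivAt.sqrt (pow_ne_zero 2 hy0)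
    simp only [Real.sqrt_sq (norm_nonneg _)] at h
    convert! h using 1
    ext v
    simp
    field_simp
  have h2 := (hasDerivAt_zpow (-k : ℤ) ‖y‖ (Or.inl hy0)).comp_hasFDerivAt y h1
  simp only [Function.comp_def, zpow_neg, zpow_natCast] at h2
  convert! h2 using 1
  rw [smul_smul]
  congr 1
  rw [show (-(k : ℤ) - 1) = -((k + 1 : ℕ) : ℤ) by push_cast; ring, zpow_neg, zpow_natCast]
  push_cast
  field_simp
  ring

theorem hasFDerivAt_inv_norm_pow_smul (n : ℕ) {y : E} (hy : y ≠ 0) :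
    HasFDerivAt (fun y : E ↦ (‖y‖ ^ n)⁻¹ • y) ((‖y‖ ^ n)⁻¹ • ContinuousLinearMap.id ℝ E +
      ((-n * (‖y‖ ^ (n + 2))⁻¹ : ℝ) • innerSL ℝ y).smulRight y) y :=
  (hasFDerivAt_inv_norm_pow n hy).smul (hasFDerivAt_id y)

theorem norm_inv_norm_pow_deriv_le (k : ℕ) (y : E) :
    ‖(-k * (‖y‖ ^ (k + 2))⁻¹ : ℝ) • innerSL ℝ y‖ ≤ k * (‖y‖ ^ (k + 1))⁻¹ := by
  rw [norm_smul, innerSL_apply_norm, norm_mul, norm_neg, norm_inv, norm_pow, norm_norm,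
    RCLike.norm_natCast, mul_assoc]
  gcongr
  exact norm_mul_inv_norm_pow_succ_le y (k + 1)

theorem norm_inv_norm_pow_smul_deriv_le (n : ℕ) (y : E) :
    ‖(‖y‖ ^ n)⁻¹ • ContinuousLinearMap.id ℝ E +
      ((-n * (‖y‖ ^ (n + 2))⁻¹ : ℝ) • innerSL ℝ y).smulRight y‖ ≤ (n + 1) * (‖y‖ ^ n)⁻¹ := by
  calc
    _ ≤ (‖y‖ ^ n)⁻¹ * 1 + n * (‖y‖ ^ (n + 1))⁻¹ * ‖y‖ := by
      refine (norm_add_le _ _).trans ?_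
      rw [norm_smul, norm_inv, norm_pow, norm_norm, ContinuousLinearMap.norm_smulRight_apply]
      gcongr
      · exact ContinuousLinearMap.norm_id_le
      · exact norm_inv_norm_pow_deriv_le n y
    _ ≤ (‖y‖ ^ n)⁻¹ * 1 + n * (‖y‖ ^ n)⁻¹ := by
      rw [mul_assoc (n : ℝ)]
      gcongr
      exact norm_mul_inv_norm_pow_succ_le y n
    _ = _ := by ring

variable [FiniteDimensional ℝ E] [MeasurableSpace E] [BorelSpace E] {μ ν : Measure E}
  [μ.IsAddHaarMeasure] [IsFiniteMeasure ν]

theorem measurable_inv_norm_pow {E : Type*} [NormedAddCommGroup E] [MeasurableSpace E]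
    [OpensMeasurableSpace E] (k : ℕ) : Measurable fun y : E ↦ (‖y‖ ^ k)⁻¹ := by
  fun_prop

theorem stronglyMeasurable_inv_norm_pow_deriv (k : ℕ) :
    StronglyMeasurable fun y : E ↦ (-k * (‖y‖ ^ (k + 2))⁻¹ : ℝ) • innerSL ℝ y :=
  ((measurable_inv_norm_pow (k + 2)).const_mul _).stronglyMeasurable.smul
    (innerSL ℝ (E := E)).continuous.stronglyMeasurable

theorem stronglyMeasurable_inv_norm_pow_smul (n : ℕ) :
    StronglyMeasurable fun y : E ↦ (‖y‖ ^ n)⁻¹ • y :=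
  (measurable_inv_norm_pow n).stronglyMeasurable.smul stronglyMeasurable_id

theorem stronglyMeasurable_inv_norm_pow_smul_deriv (n : ℕ) :
    StronglyMeasurable fun y : E ↦ (‖y‖ ^ n)⁻¹ • ContinuousLinearMap.id ℝ E +
      ((-n * (‖y‖ ^ (n + 2))⁻¹ : ℝ) • innerSL ℝ y).smulRight y := by
  refine ((measurable_inv_norm_pow n).stronglyMeasurable.smul_const _).add ?_
  have h : Continuous fun p : (E →L[ℝ] ℝ) × E ↦ p.1.smulRight p.2 := by fun_prop
  exact h.comp_stronglyMeasurable
    ((stronglyMeasurable_inv_norm_pow_deriv n).prodMk stronglyMeasurable_id)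

theorem integrable_inv_norm_sub_pow_smul {C : ℝ≥0∞} (hC : C ≠ ∞) (hν : ν ≤ C • μ) {n : ℕ}
    (hn : n < Module.finrank ℝ E) (s : E) :
    Integrable (fun x ↦ (‖s - x‖ ^ (n + 1))⁻¹ • (s - x)) ν := by
  refine integrable_of_norm_le_inv_norm_sub_pow hC hν hn (M := 1) (u := s)
    ((stronglyMeasurable_inv_norm_pow_smul _).comp_measurable
      (measurable_const.sub measurable_id)).aestronglyMeasurable fun x ↦ ?_
  rw [norm_smul, norm_inv, norm_pow, norm_norm, one_mul]
  exact norm_mul_inv_norm_pow_succ_le (s - x) n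

theorem integrable_inv_norm_sub_pow_smul_deriv {C : ℝ≥0∞} (hC : C ≠ ∞) (hν : ν ≤ C • μ) {n : ℕ}
    (hn : n < Module.finrank ℝ E) (s : E) :
    Integrable (fun x ↦ (‖s - x‖ ^ n)⁻¹ • ContinuousLinearMap.id ℝ E +
      ((-n * (‖s - x‖ ^ (n + 2))⁻¹ : ℝ) • innerSL ℝ (s - x)).smulRight (s - x)) ν :=
  integrable_of_norm_le_inv_norm_sub_pow hC hν hn
    ((stronglyMeasurable_inv_norm_pow_smul_deriv n).comp_measurable
      (measurable_const.sub measurable_id)).aestronglyMeasurable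
    fun x ↦ norm_inv_norm_pow_smul_deriv_le n (s - x)

theorem hasGradientAt_integral_inv_norm_sub_pow {C : ℝ≥0∞} (hC : C ≠ ∞) (hν : ν ≤ C • μ) {k : ℕ}
    (hk : k + 1 < Module.finrank ℝ E) (s : E) :
    HasGradientAt (fun u ↦ ∫ x, (‖u - x‖ ^ k)⁻¹ ∂ν)
      (-(k : ℝ) • ∫ x, (‖s - x‖ ^ (k + 2))⁻¹ • (s - x) ∂ν) s := by
  have h := hasFDerivAt_integral_sub_of_singular hC hν hk
    (measurable_inv_norm_pow k).stronglyMeasurable (stronglyMeasurable_inv_norm_pow_deriv k)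
    (fun y hy ↦ hasFDerivAt_inv_norm_pow k hy) (Nat.cast_nonneg k) (fun y ↦ by simp)
    (norm_inv_norm_pow_deriv_le k) (fun y z ↦ ?_) s
  · rw [hasGradientAt_iff_hasFDerivAt]
    refine h.congr_fderiv ?_
    ext v
    have hi := integrable_inv_norm_sub_pow_smul hC hν hk s
    have hi' : Integrable (fun x ↦ (-k * (‖s - x‖ ^ (k + 2))⁻¹ : ℝ) • innerSL ℝ (s - x)) ν := by
      have := ((innerSL ℝ (E := E)).integrable_comp hi).smul (-(k : ℝ))
      refine this.congr (ae_of_all _ fun x ↦ ?_)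
      simp [smul_smul]
    rw [ContinuousLinearMap.integral_apply hi', InnerProductSpace.toDual_apply_apply,
      real_inner_comm, inner_smul_right, ← integral_inner hi, ← integral_const_mul]
    refine integral_congr_ae (ae_of_all _ fun x ↦ ?_)
    simp [inner_smul_right, real_inner_comm v, mul_assoc, inner_sub_right]
  · refine (abs_inv_pow_sub_inv_pow_le (norm_nonneg y) (norm_nonneg z) k).trans ?_
    gcongr
    exact abs_norm_sub_norm_le y z

theorem hasFDerivAt_integral_inv_norm_sub_pow_smul {C : ℝ≥0∞} (hC : C ≠ ∞) (hν : ν ≤ C • μ)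
    {n : ℕ} (hn : n + 1 < Module.finrank ℝ E) (s : E) :
    HasFDerivAt (fun u ↦ ∫ x, (‖u - x‖ ^ (n + 1))⁻¹ • (u - x) ∂ν)
      (∫ x, ((‖s - x‖ ^ (n + 1))⁻¹ • ContinuousLinearMap.id ℝ E +
        ((-(n + 1 : ℕ) * (‖s - x‖ ^ (n + 1 + 2))⁻¹ : ℝ) • innerSL ℝ (s - x)).smulRight
          (s - x)) ∂ν) s :=
  hasFDerivAt_integral_sub_of_singular hC hν hn
    (stronglyMeasurable_inv_norm_pow_smul (n + 1))
    (stronglyMeasurable_inv_norm_pow_smul_deriv (n + 1))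
    (fun y hy ↦ hasFDerivAt_inv_norm_pow_smul (n + 1) hy)
    (by positivity : (0 : ℝ) ≤ (n + 1 : ℕ) + 1)
    (fun y ↦ by
      rw [norm_smul, norm_inv, norm_pow, norm_norm]
      exact norm_mul_inv_norm_pow_succ_le y n)
    (norm_inv_norm_pow_smul_deriv_le (n + 1))
    (norm_inv_norm_pow_smul_sub_le (n + 1)) s

end Kernel

theorem Matrix.toEuclideanLin_single_one_apply {m n : Type*} [Fintype n] [DecidableEq n]
    (A : Matrix m n ℝ) (i : m) (j : n) :
    Matrix.toEuclideanLin A (EuclideanSpace.single j 1) i = A i j := by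
  simp [Matrix.toLpLin_apply]

/-- **Lemma 3.** For `d ≥ 3`, a bounded probability density `ρ` on `ℝ^d` and `0 ≤ k ≤ d - 3`,
the Hessian (second Fréchet derivative) of `G(s) = ∫ ‖s - x‖₂⁻ᵏ ρ(x) dx` exists at every `s`
and is the matrix
`-k ∫ (I_d / ‖s-x‖^{k+2} - (k+2) (s-x)(s-x)ᵀ / ‖s-x‖^{k+4}) ρ(x) dx`.
The first conjunct records that the gradient of `G` exists everywhere and is given by the
formula of Lemma 2; the second conjunct states that this gradient map is Fréchet
differentiable at `s` with derivative the linear map associated with the Hessian matrix. -/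
theorem hasHessianAt_integral_inv_norm_pow
    (d : ℕ) (hd : 3 ≤ d)
    (ρ : EuclideanSpace ℝ (Fin d) → ℝ)
    (hρ_meas : Measurable ρ)
    (hρ_nonneg : ∀ x, 0 ≤ ρ x)
    (C : ℝ) (hρ_bdd : ∀ᵐ x ∂volume, ρ x ≤ C)
    (hρ_int : ∫ x, ρ x ∂volume = 1)
    (k : ℕ) (hk : k ≤ d - 3)
    (s : EuclideanSpace ℝ (Fin d)) :
    (∀ t, HasGradientAt (fun u => ∫ x, ρ x / ‖u - x‖ ^ k ∂volume)
        ((-(k : ℝ)) • ∫ x, (ρ x / ‖t - x‖ ^ (k + 2)) • (t - x) ∂volume) t) ∧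
    HasFDerivAt
      (fun t => (-(k : ℝ)) • ∫ x, (ρ x / ‖t - x‖ ^ (k + 2)) • (t - x) ∂volume)
      ((Matrix.toEuclideanLin
        (fun i j => -(k : ℝ) * ∫ x,
          ((if i = j then (1 : ℝ) else 0) / ‖s - x‖ ^ (k + 2)
            - (k + 2) * ((s - x) i * (s - x) j) / ‖s - x‖ ^ (k + 4)) * ρ x
              ∂volume : Matrix (Fin d) (Fin d) ℝ)).toContinuousLinearMap) s := by
  set ν : Measure (EuclideanSpace ℝ (Fin d)) :=
    volume.withDensity fun x ↦ ENNReal.ofReal (ρ x) with hνdef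
  have hρi : Integrable ρ := by
    by_contra h
    simp [integral_undef h] at hρ_int
  have : IsFiniteMeasure ν := isFiniteMeasure_withDensity_ofReal hρi.2
  have hν : ν ≤ ENNReal.ofReal C • volume := by
    rw [← withDensity_const]
    exact withDensity_mono (hρ_bdd.mono fun x hx ↦ ENNReal.ofReal_le_ofReal hx)
  have hint {F : Type} [NormedAddCommGroup F] [NormedSpace ℝ F]
      (g : EuclideanSpace ℝ (Fin d) → F) : ∫ x, g x ∂ν = ∫ x, ρ x • g x := by
    rw [hνdef, integral_withDensity_eq_integral_toReal_smul (by fun_prop)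
      (ae_of_all _ fun _ ↦ ENNReal.ofReal_lt_top)]
    simp only [ENNReal.toReal_ofReal (hρ_nonneg _)]
  have hdim : k + 1 + 1 < Module.finrank ℝ (EuclideanSpace ℝ (Fin d)) := by
    rw [finrank_euclideanSpace_fin]
    omega
  have hfield (t : EuclideanSpace ℝ (Fin d)) :
      ∫ x, (ρ x / ‖t - x‖ ^ (k + 2)) • (t - x) =
        ∫ x, (‖t - x‖ ^ (k + 2))⁻¹ • (t - x) ∂ν := by
    simp only [hint, smul_smul, div_eq_mul_inv]
  simp only [hfield]
  refine ⟨fun t ↦ ?_, ?_⟩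
  · have h := hasGradientAt_integral_inv_norm_sub_pow ENNReal.ofReal_ne_top hν
      (Nat.lt_of_succ_lt hdim) t
    simpa only [hint fun x ↦ (‖_ - x‖ ^ k)⁻¹, smul_eq_mul, ← div_eq_mul_inv] using h
  · have h := (hasFDerivAt_integral_inv_norm_sub_pow_smul ENNReal.ofReal_ne_top hν hdim s).const_smul
      (-(k : ℝ))
    have hi := integrable_inv_norm_sub_pow_smul_deriv ENNReal.ofReal_ne_top hν hdim s
    refine h.congr_fderiv (ContinuousLinearMap.coe_injective ?_)
    refine (EuclideanSpace.basisFun (Fin d) ℝ).toBasis.ext fun j ↦ ?_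
    ext i
    rw [OrthonormalBasis.coe_toBasis, EuclideanSpace.basisFun_apply]
    refine Eq.symm ((Matrix.toEuclideanLin_single_one_apply _ i j).trans ?_)
    rw [ContinuousLinearMap.coe_coe, _root_.smul_apply, PiLp.smul_apply, smul_eq_mul,
      ContinuousLinearMap.integral_apply hi]
    have hp := (EuclideanSpace.proj i : EuclideanSpace ℝ (Fin d) →L[ℝ] ℝ).integral_comp_comm
      (hi.apply_continuousLinearMap (EuclideanSpace.single j 1))
    refine congrArg (-(k : ℝ) * ·) (Eq.trans ?_ hp)
    rw [hint]
    refine integral_congr_ae (ae_of_all _ fun x ↦ ?_)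
    simp [EuclideanSpace.inner_single_right, div_eq_mul_inv]
    ring
end

section
/- Let ρ be a bounded probability density on ℝ and define f_μ(s) = ∫_ℝ (|s−x| − |x|) ρ(x) dx. Then for almost every s ∈ ℝ, the second derivative f_μ″(s) exists and equals 2 ρ(s). -/
open MeasureTheory

theorem abs_abs_sub_sub_abs_le (t x : ℝ) : |(|t - x| - |x|)| ≤ |t| := by
  have h := abs_abs_sub_abs_le (t - x) (-x)
  simpa using h

theorem hasDerivAt_integral_abs_sub_sub_abs_mul {ρ : ℝ → ℝ} (hρ : Integrable ρ) (t : ℝ) :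
    HasDerivAt (fun t => ∫ x, (|t - x| - |x|) * ρ x)
      (2 * (∫ x in Set.Iic t, ρ x) - ∫ x, ρ x) t := by
  have hmeas : ∀ s : ℝ, AEStronglyMeasurable (fun x => (|s - x| - |x|) * ρ x) volume := fun s =>
    (by fun_prop : Continuous fun x : ℝ => |s - x| - |x|).aestronglyMeasurable.mul hρ.1
  have hint : Integrable fun x => (|t - x| - |x|) * ρ x :=
    hρ.bdd_mul (c := |t|)
      (by fun_prop : Continuous fun x : ℝ => |t - x| - |x|).aestronglyMeasurable
      (.of_forall fun x => abs_abs_sub_sub_abs_le t x)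
  have hind : Integrable ((Set.Iic t).indicator ρ) := hρ.indicator measurableSet_Iic
  have key := (hasDerivAt_integral_of_dominated_loc_of_lip (𝕜 := ℝ) (μ := volume)
    (F := fun t x => (|t - x| - |x|) * ρ x)
    (F' := fun x => 2 * (Set.Iic t).indicator ρ x - ρ x) (bound := ρ)
    (x₀ := t) Filter.univ_mem (.of_forall hmeas) hint ((hind.const_mul 2).sub hρ).1 ?_ hρ ?_).2
  · rwa [integral_sub (hind.const_mul 2) hρ, integral_const_mul,
      integral_indicator measurableSet_Iic] at key
  · refine .of_forall fun x => LipschitzOnWith.of_dist_le_mul fun a _ b _ => ?_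
    have h := abs_abs_sub_abs_le (a - x) (b - x)
    rw [sub_sub_sub_cancel_right] at h
    rw [Real.dist_eq, Real.dist_eq, Real.coe_nnabs, ← sub_mul, sub_sub_sub_cancel_right, abs_mul,
      mul_comm]
    gcongr
  · filter_upwards [Measure.ae_ne volume t] with x hx
    rcases lt_or_gt_of_ne hx with h | h
    · have := ((hasDerivAt_abs_pos (sub_pos.2 h)).comp_sub_const t x).sub_const |x|
      refine (this.mul_const (ρ x)).congr_deriv ?_
      rw [Set.indicator_of_mem (Set.mem_Iic.2 h.le)]
      ring
    · have := ((hasDerivAt_abs_neg (sub_neg.2 h)).comp_sub_const t x).sub_const |x|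
      refine (this.mul_const (ρ x)).congr_deriv ?_
      rw [Set.indicator_of_notMem (Set.notMem_Iic.2 h)]
      ring

/-- **Lemma 4.** Let `ρ` be a bounded probability density on `ℝ` and
`f_μ(s) = ∫ (|s-x| - |x|) ρ(x) dx`.  Then for almost every `s ∈ ℝ` the second
derivative `f_μ''(s)` exists and equals `2 ρ(s)`. -/
theorem second_deriv_K_function_one_dim
    (ρ : ℝ → ℝ)
    (hρ_meas : Measurable ρ)
    (hρ_nonneg : ∀ x, 0 ≤ ρ x)
    (C : ℝ) (hρ_bdd : ∀ᵐ x ∂volume, ρ x ≤ C)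
    (hρ_int : ∫ x, ρ x ∂volume = 1) :
    ∀ᵐ s ∂(volume : Measure ℝ),
      HasDerivAt (deriv (fun t => ∫ x, (|t - x| - |x|) * ρ x ∂volume)) (2 * ρ s) s := by
  have hρ : Integrable ρ := .of_integral_ne_zero (by simp [hρ_int])
  have hderiv : deriv (fun t => ∫ x, (|t - x| - |x|) * ρ x) =
      fun t => 2 * ((∫ x in Set.Iic 0, ρ x) + ∫ x in (0 : ℝ)..t, ρ x) - ∫ x, ρ x := by
    funext t
    rw [(hasDerivAt_integral_abs_sub_sub_abs_mul hρ t).deriv,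
      ← intervalIntegral.integral_Iic_sub_Iic hρ.integrableOn hρ.integrableOn]
    ring
  filter_upwards [LocallyIntegrable.ae_hasDerivAt_integral hρ.locallyIntegrable] with s hs
  rw [hderiv]
  exact (((hs 0).const_add _).const_mul 2).sub_const _
end

section
/- Let d ≥ 3 and let ρ be a bounded probability density on ℝ^d with K-function f_μ. Then f_μ is Fréchet differentiable at every s ∈ ℝ^d with gradient ∇f_μ(s) = ∫_{ℝ^d} (s−x)/‖s−x‖₂ · ρ(x) dx. -/
open MeasureTheory

theorem hasFDerivAt_norm_of_ne_zero {E : Type*} [NormedAddCommGroup E] [InnerProductSpace ℝ E]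
    {x : E} (hx : x ≠ 0) : HasFDerivAt (fun y : E => ‖y‖) (‖x‖⁻¹ • innerSL ℝ x) x := by
  have h := (hasStrictFDerivAt_norm_sq x).hasFDerivAt.sqrt (by simpa using hx)
  simp only [Real.sqrt_sq (norm_nonneg _)] at h
  convert! h using 1
  ext v
  simp
  ring

/-- For `d ≥ 3` and a bounded probability density `ρ` on `ℝ^d`, the K-function
`f_μ(s) = ∫ (‖s-x‖₂ - ‖x‖₂) ρ(x) dx` is Fréchet differentiable at every `s` with
gradient `∇f_μ(s) = ∫ (s-x)/‖s-x‖₂ ⬝ ρ(x) dx`. -/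
theorem hasGradientAt_K_function
    (d : ℕ) (hd : 3 ≤ d)
    (ρ : EuclideanSpace ℝ (Fin d) → ℝ)
    (hρ_meas : Measurable ρ)
    (hρ_nonneg : ∀ x, 0 ≤ ρ x)
    (C : ℝ) (hρ_bdd : ∀ᵐ x ∂volume, ρ x ≤ C)
    (hρ_int : ∫ x, ρ x ∂volume = 1)
    (s : EuclideanSpace ℝ (Fin d)) :
    HasGradientAt (fun t => ∫ x, (‖t - x‖ - ‖x‖) * ρ x ∂volume)
      (∫ x, (ρ x / ‖s - x‖) • (s - x) ∂volume) s := by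
  have : NeZero d := ⟨by omega⟩
  have hρ : Integrable ρ volume := .of_integral_ne_zero (by simp [hρ_int])
  have hgrad_meas : Measurable fun x => (ρ x / ‖s - x‖) • (s - x) := by fun_prop
  have hgrad_int : Integrable (fun x => (ρ x / ‖s - x‖) • (s - x)) volume := by
    refine hρ.mono' hgrad_meas.aestronglyMeasurable (.of_forall fun x => ?_)
    rw [norm_smul, norm_div, norm_norm, Real.norm_of_nonneg (hρ_nonneg x), div_mul_eq_mul_div,
      mul_div_assoc]
    exact mul_le_of_le_one_right (hρ_nonneg x) (div_self_le_one _)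
  have hmeas (t : EuclideanSpace ℝ (Fin d)) : Measurable fun x => (‖t - x‖ - ‖x‖) * ρ x := by
    fun_prop
  have hint : Integrable (fun x => (‖s - x‖ - ‖x‖) * ρ x) volume := by
    refine (hρ.const_mul ‖s‖).mono' (hmeas s).aestronglyMeasurable (.of_forall fun x => ?_)
    rw [norm_mul, Real.norm_of_nonneg (hρ_nonneg x), Real.norm_eq_abs]
    have := abs_norm_sub_norm_le (s - x) (-x)
    simp only [norm_neg, sub_neg_eq_add, sub_add_cancel] at this
    exact mul_le_mul_of_nonneg_right this (hρ_nonneg x)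
  obtain ⟨hF'_int, hderiv⟩ := hasFDerivAt_integral_of_dominated_loc_of_lip
    (𝕜 := ℝ) (μ := volume) (F := fun t x => (‖t - x‖ - ‖x‖) * ρ x) (bound := ρ) (x₀ := s)
    (F' := fun x => innerSL ℝ ((ρ x / ‖s - x‖) • (s - x))) Filter.univ_mem
    (.of_forall fun t => (hmeas t).aestronglyMeasurable) hint
    ((innerSL ℝ).continuous.comp_aestronglyMeasurable hgrad_meas.aestronglyMeasurable)
    (.of_forall fun x => by
      refine LipschitzOnWith.of_dist_le_mul fun t _ u _ => ?_
      rw [Real.dist_eq, dist_eq_norm, ← sub_mul, sub_sub_sub_cancel_right, abs_mul, mul_comm,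
        Real.coe_nnabs]
      gcongr
      simpa using abs_norm_sub_norm_le (t - x) (u - x))
    hρ (by
      filter_upwards [Measure.ae_ne volume s] with x hx
      have h := (hasFDerivAt_norm_of_ne_zero (sub_ne_zero.2 hx.symm)).comp s
        ((hasFDerivAt_id s).sub_const x)
      convert! (h.sub_const ‖x‖).mul_const (ρ x) using 1
      ext v
      simp
      ring)
  rw [hasGradientAt_iff_hasFDerivAt]
  convert! hderiv using 1
  ext v
  rw [ContinuousLinearMap.integral_apply hF'_int, InnerProductSpace.toDual_apply_apply,
    real_inner_comm, ← integral_inner hgrad_int]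
  simp only [innerSL_apply_apply, real_inner_comm]
end

section
/- Let d ≥ 3 and let ρ be a bounded probability density on ℝ^d with K-function f_μ. Then for every s ∈ ℝ^d, the Hessian of f_μ at s exists and equals ∫_{ℝ^d} [ I_d / ‖s−x‖₂ − (s−x)(s−x)^T / ‖s−x‖₂³ ] ρ(x) dx, and this matrix is symmetric and positive definite. -/
open MeasureTheory

section UnitVector

variable {E : Type*} [NormedAddCommGroup E] [InnerProductSpace ℝ E]

theorem hasFDerivAt_norm_of_ne_zero_s10 {z : E} (hz : z ≠ 0) :
    HasFDerivAt (fun w : E => ‖w‖) (‖z‖⁻¹ • innerSL ℝ z) z := by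
  have h := (hasStrictFDerivAt_norm_sq z).hasFDerivAt.sqrt (by simpa using hz)
  simp only [Real.sqrt_sq (norm_nonneg _)] at h
  convert! h using 1
  ext v
  have : ‖z‖ ≠ 0 := norm_ne_zero_iff.2 hz
  simp
  field_simp

/-- The derivative of `z ↦ ‖z‖⁻¹ • z` away from the origin. -/
noncomputable def unitVectorDeriv (z : E) : E →L[ℝ] E :=
  ‖z‖⁻¹ • ContinuousLinearMap.id ℝ E - (‖z‖ ^ 3)⁻¹ • (innerSL ℝ z).smulRight z

theorem unitVectorDeriv_apply (z v : E) :
    unitVectorDeriv z v = ‖z‖⁻¹ • v - ((‖z‖ ^ 3)⁻¹ * inner ℝ z v) • z := by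
  simp [unitVectorDeriv, smul_smul]

theorem hasFDerivAt_inv_norm_smul {z : E} (hz : z ≠ 0) :
    HasFDerivAt (fun w : E => ‖w‖⁻¹ • w) (unitVectorDeriv z) z := by
  have hn : ‖z‖ ≠ 0 := norm_ne_zero_iff.2 hz
  have h := ((hasDerivAt_inv hn).comp_hasFDerivAt z (hasFDerivAt_norm_of_ne_zero_s10 hz)).smul
    (hasFDerivAt_id z)
  convert! h using 1
  ext v
  simp only [unitVectorDeriv_apply, add_apply,
    smul_apply, ContinuousLinearMap.smulRight_apply, innerSL_apply_apply,
    ContinuousLinearMap.id_apply, Function.comp, id, smul_eq_mul]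
  rw [sub_eq_add_neg, ← neg_smul]
  congr 2
  field_simp

theorem norm_inv_norm_smul_sub_le (w : E) {z : E} (hz : z ≠ 0) :
    ‖‖w‖⁻¹ • w - ‖z‖⁻¹ • z‖ ≤ 2 * ‖z‖⁻¹ * ‖w - z‖ := by
  have hn : 0 < ‖z‖ := norm_pos_iff.2 hz
  have key : ‖(‖w‖⁻¹ - ‖z‖⁻¹) • w‖ ≤ ‖z‖⁻¹ * ‖w - z‖ := by
    rcases eq_or_ne w 0 with rfl | hw
    · simpa using mul_nonneg (inv_nonneg.2 hn.le) hn.le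
    have hw' : 0 < ‖w‖ := norm_pos_iff.2 hw
    have : (‖w‖⁻¹ - ‖z‖⁻¹) * ‖w‖ = ‖z‖⁻¹ * (‖z‖ - ‖w‖) := by field_simp
    rw [norm_smul, ← norm_norm w, ← norm_mul, norm_norm, this, norm_mul, norm_inv, norm_norm]
    rw [norm_sub_rev w z]
    gcongr
    exact abs_norm_sub_norm_le z w
  calc ‖‖w‖⁻¹ • w - ‖z‖⁻¹ • z‖
      = ‖(‖w‖⁻¹ - ‖z‖⁻¹) • w + ‖z‖⁻¹ • (w - z)‖ := by
        congr 1; rw [sub_smul, smul_sub]; abel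
    _ ≤ ‖z‖⁻¹ * ‖w - z‖ + ‖z‖⁻¹ * ‖w - z‖ := by
        refine (norm_add_le _ _).trans (add_le_add key ?_)
        rw [norm_smul, norm_inv, norm_norm]
    _ = _ := by ring

theorem inner_unitVectorDeriv_nonneg (z v : E) : 0 ≤ inner ℝ v (unitVectorDeriv z v) := by
  rcases eq_or_ne z 0 with rfl | hz
  · simp [unitVectorDeriv_apply]
  have hn : 0 < ‖z‖ := norm_pos_iff.2 hz
  have hcs := real_inner_mul_inner_self_le z v
  rw [real_inner_self_eq_norm_sq, real_inner_self_eq_norm_sq] at hcs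
  have : inner ℝ v (unitVectorDeriv z v)
      = (‖z‖ ^ 3)⁻¹ * (‖z‖ ^ 2 * ‖v‖ ^ 2 - inner ℝ z v * inner ℝ z v) := by
    rw [unitVectorDeriv_apply, inner_sub_right, real_inner_smul_right, real_inner_smul_right,
      real_inner_self_eq_norm_sq, real_inner_comm z v]
    field_simp
  rw [this]
  exact mul_nonneg (by positivity) (by linarith)

theorem mem_span_of_inner_unitVectorDeriv_eq_zero {z v : E} (hv : v ≠ 0)
    (h : inner ℝ v (unitVectorDeriv z v) = 0) : z ∈ Submodule.span ℝ {v} := by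
  rcases eq_or_ne z 0 with rfl | hz
  · exact Submodule.zero_mem _
  have hn : 0 < ‖z‖ := norm_pos_iff.2 hz
  rw [unitVectorDeriv_apply, inner_sub_right, real_inner_smul_right, real_inner_smul_right,
    real_inner_self_eq_norm_sq, real_inner_comm v z] at h
  have h2 : inner ℝ v z * inner ℝ v z = (‖v‖ * ‖z‖) * (‖v‖ * ‖z‖) := by
    field_simp at h
    linarith
  have h3 : ‖inner ℝ v z‖ = ‖v‖ * ‖z‖ := by
    rw [← abs_of_nonneg (by positivity : 0 ≤ ‖v‖ * ‖z‖), Real.norm_eq_abs]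
    exact abs_eq_abs.2 (mul_self_eq_mul_self_iff.1 h2)
  obtain ⟨r, -, hr⟩ := (norm_inner_eq_norm_iff hv hz).1 h3
  exact Submodule.mem_span_singleton.2 ⟨r, hr.symm⟩

end UnitVector

section Potential

variable {E : Type*} [NormedAddCommGroup E] [InnerProductSpace ℝ E] [FiniteDimensional ℝ E]
  [MeasurableSpace E] [BorelSpace E] {μ : Measure E} {ρ : E → ℝ}

theorem integrable_div_norm_smul (hρ : Integrable ρ μ) (hρ_nonneg : ∀ x, 0 ≤ ρ x) (t : E) :
    Integrable (fun x => (ρ x / ‖t - x‖) • (t - x)) μ := by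
  refine hρ.mono' ?_ (.of_forall fun x => ?_)
  · exact (hρ.aestronglyMeasurable.mul (g := fun x => ‖t - x‖⁻¹) (by fun_prop)).smul
      (by fun_prop)
  · rw [norm_smul, norm_div, norm_norm, Real.norm_of_nonneg (hρ_nonneg x)]
    rcases eq_or_ne ‖t - x‖ 0 with h | h
    · simpa [h] using hρ_nonneg x
    · rw [div_mul_cancel₀ _ h]

theorem measurable_unitVectorDeriv : Measurable (unitVectorDeriv : E → E →L[ℝ] E) := by
  have : Continuous fun z : E => (innerSL ℝ z).smulRight z :=
    ((ContinuousLinearMap.smulRightL ℝ E E).continuous.comp (innerSL ℝ).continuous).clm_apply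
      continuous_id
  exact (measurable_norm.inv.smul_const _).sub ((measurable_norm.pow_const 3).inv.smul
    this.measurable)

variable [μ.IsAddHaarMeasure]

theorem locallyIntegrable_inv_norm (hdim : 2 ≤ Module.finrank ℝ E) :
    LocallyIntegrable (fun x : E => ‖x‖⁻¹) μ := by
  refine locallyIntegrable_of_norm_le_rpow (C := 1) (α := 1) (by lia) (by exact_mod_cast hdim)
    (.of_forall fun x => ?_) measurable_norm.inv.aestronglyMeasurable
  simp [Real.rpow_neg_one]

theorem integrable_mul_inv_norm_sub (hdim : 2 ≤ Module.finrank ℝ E) (hρ : Integrable ρ μ)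
    (hρ_nonneg : ∀ x, 0 ≤ ρ x) {C : ℝ} (hC : ∀ᵐ x ∂μ, ρ x ≤ C) (t : E) :
    Integrable (fun x => ρ x * ‖t - x‖⁻¹) μ := by
  have hloc : Integrable ((Metric.closedBall (0 : E) 1).indicator fun x => ‖x‖⁻¹) μ :=
    ((locallyIntegrable_inv_norm hdim).integrableOn_isCompact
      (isCompact_closedBall 0 1)).integrable_indicator measurableSet_closedBall
  refine ((hloc.comp_sub_left t).const_mul C |>.add hρ).mono' ?_ ?_
  · exact hρ.aestronglyMeasurable.mul (by fun_prop)
  · filter_upwards [hC] with x hx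
    have h0 := hρ_nonneg x
    rw [Real.norm_of_nonneg (by positivity), Pi.add_apply]
    by_cases h : t - x ∈ Metric.closedBall (0 : E) 1
    · rw [Set.indicator_of_mem h]
      have : ρ x * ‖t - x‖⁻¹ ≤ C * ‖t - x‖⁻¹ := by gcongr
      linarith
    · rw [Set.indicator_of_notMem h]
      rw [mem_closedBall_zero_iff, not_le] at h
      have : ρ x * ‖t - x‖⁻¹ ≤ ρ x * 1 := by gcongr; exact inv_le_one_of_one_le₀ h.le
      linarith

theorem ae_sub_ne_zero [Nontrivial E] (t : E) : ∀ᵐ x ∂μ, t - x ≠ 0 := by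
  filter_upwards [Measure.ae_ne μ t] with x hx
  exact sub_ne_zero.2 hx.symm

theorem hasGradientAt_integral_norm_sub [Nontrivial E] (hρ : Integrable ρ μ)
    (hρ_nonneg : ∀ x, 0 ≤ ρ x) (t : E) :
    HasGradientAt (fun u => ∫ x, (‖u - x‖ - ‖x‖) * ρ x ∂μ)
      (∫ x, (ρ x / ‖t - x‖) • (t - x) ∂μ) t := by
  rw [hasGradientAt_iff_hasFDerivAt]
  have hm := hρ.aestronglyMeasurable
  have hint := integrable_div_norm_smul hρ hρ_nonneg t
  have key := (hasFDerivAt_integral_of_dominated_loc_of_lip' (μ := μ) (s := Set.univ) (x₀ := t)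
    (F := fun u x => (‖u - x‖ - ‖x‖) * ρ x) (bound := ρ)
    (F' := fun x => InnerProductSpace.toDual ℝ E ((ρ x / ‖t - x‖) • (t - x)))
    Filter.univ_mem (fun u _ => ?_) ?_ ?_ ?_ hρ ?_).2
  · convert! key using 1
    exact ((InnerProductSpace.toDual ℝ E).toContinuousLinearEquiv.integral_comp_comm _).symm
  · exact AEStronglyMeasurable.mul (by fun_prop) hm
  · refine (hρ.const_mul ‖t‖).mono' (AEStronglyMeasurable.mul (by fun_prop) hm)
      (.of_forall fun x => ?_)
    rw [norm_mul, Real.norm_of_nonneg (hρ_nonneg x)]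
    gcongr
    · exact hρ_nonneg x
    · simpa using abs_norm_sub_norm_le (t - x) (-x)
  · exact (InnerProductSpace.toDual ℝ E).continuous.comp_aestronglyMeasurable
      hint.aestronglyMeasurable
  · refine .of_forall fun x u _ => ?_
    rw [← sub_mul, norm_mul, Real.norm_of_nonneg (hρ_nonneg x), mul_comm, sub_sub_sub_cancel_right]
    gcongr
    · exact hρ_nonneg x
    · simpa using abs_norm_sub_norm_le (u - x) (t - x)
  · filter_upwards [ae_sub_ne_zero (μ := μ) t] with x hx
    have h := (((hasFDerivAt_norm_of_ne_zero_s10 hx).comp t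
      ((hasFDerivAt_id t).sub_const x)).sub_const ‖x‖).mul_const (ρ x)
    convert! h using 1
    ext v
    simp
    ring

theorem hasFDerivAt_integral_inv_norm_smul (hdim : 2 ≤ Module.finrank ℝ E) (hρ : Integrable ρ μ)
    (hρ_nonneg : ∀ x, 0 ≤ ρ x) {C : ℝ} (hC : ∀ᵐ x ∂μ, ρ x ≤ C) (t : E) :
    Integrable (fun x => ρ x • unitVectorDeriv (t - x)) μ ∧
    HasFDerivAt (fun u => ∫ x, (ρ x / ‖u - x‖) • (u - x) ∂μ)
      (∫ x, ρ x • unitVectorDeriv (t - x) ∂μ) t := by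
  have : Nontrivial E := Module.nontrivial_of_finrank_pos (R := ℝ) (by lia)
  have hm := hρ.aestronglyMeasurable
  refine hasFDerivAt_integral_of_dominated_loc_of_lip' (s := Set.univ)
    (bound := fun x => 2 * (ρ x * ‖t - x‖⁻¹)) Filter.univ_mem (fun u _ =>
      (integrable_div_norm_smul hρ hρ_nonneg u).aestronglyMeasurable)
    (integrable_div_norm_smul hρ hρ_nonneg t) ?_ ?_
    ((integrable_mul_inv_norm_sub hdim hρ hρ_nonneg hC t).const_mul 2) ?_
  · exact hm.smul (measurable_unitVectorDeriv.comp (by fun_prop)).aestronglyMeasurable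
  · filter_upwards [ae_sub_ne_zero (μ := μ) t] with x hx u _
    have h := norm_inv_norm_smul_sub_le (u - x) hx
    rw [sub_sub_sub_cancel_right] at h
    rw [div_eq_mul_inv, div_eq_mul_inv, mul_smul, mul_smul, ← smul_sub, norm_smul,
      Real.norm_of_nonneg (hρ_nonneg x)]
    calc _ ≤ ρ x * (2 * ‖t - x‖⁻¹ * ‖u - t‖) := mul_le_mul_of_nonneg_left h (hρ_nonneg x)
      _ = _ := by ring
  · filter_upwards [ae_sub_ne_zero (μ := μ) t] with x hx
    have h := ((hasFDerivAt_inv_norm_smul hx).comp t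
      ((hasFDerivAt_id t).sub_const x)).const_smul (ρ x)
    convert! h using 1
    ext u
    simp [div_eq_mul_inv, mul_smul]

theorem inner_integral_unitVectorDeriv_pos (hdim : 2 ≤ Module.finrank ℝ E)
    (hρ_nonneg : ∀ x, 0 ≤ ρ x) (hρ_pos : 0 < ∫ x, ρ x ∂μ) (t : E)
    (hint : Integrable (fun x => ρ x • unitVectorDeriv (t - x)) μ) {v : E} (hv : v ≠ 0) :
    0 < inner ℝ v ((∫ x, ρ x • unitVectorDeriv (t - x) ∂μ) v) := by
  have hint' := hint.apply_continuousLinearMap v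
  rw [ContinuousLinearMap.integral_apply hint, ← integral_inner hint']
  have hnn (x : E) : 0 ≤ inner ℝ v ((ρ x • unitVectorDeriv (t - x)) v) := by
    rw [smul_apply, real_inner_smul_right]
    exact mul_nonneg (hρ_nonneg x) (inner_unitVectorDeriv_nonneg _ _)
  refine (integral_nonneg hnn).lt_of_ne' fun h0 => hρ_pos.ne' ?_
  rw [integral_eq_zero_iff_of_nonneg hnn (hint'.const_inner v)] at h0
  have hspan : Submodule.span ℝ {v} ≠ ⊤ := fun h => by
    have := finrank_span_singleton (K := ℝ) hv
    rw [h, finrank_top] at this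
    lia
  have hnull : ∀ᵐ x ∂μ, t - x ∉ Submodule.span ℝ {v} :=
    (Measure.measurePreserving_sub_left μ t).quasiMeasurePreserving.ae
      (measure_eq_zero_iff_ae_notMem.1 (Measure.addHaar_submodule μ _ hspan))
  refine integral_eq_zero_of_ae ?_
  filter_upwards [h0, hnull] with x hx hx'
  rw [smul_apply, real_inner_smul_right] at hx
  exact (mul_eq_zero.1 hx).resolve_right
    fun h => hx' (mem_span_of_inner_unitVectorDeriv_eq_zero hv h)

end Potential

/-- For `d ≥ 3` and a bounded probability density `ρ` on `ℝ^d` with K-function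
`f_μ(s) = ∫ (‖s-x‖₂ - ‖x‖₂) ρ(x) dx`, the Hessian of `f_μ` exists at every `s` and
equals the matrix `∫ (I_d/‖s-x‖₂ - (s-x)(s-x)ᵀ/‖s-x‖₂³) ρ(x) dx`, which is symmetric
and positive definite.  The first conjunct records that the gradient of `f_μ` exists
everywhere and is given by the K-transform; the second states that this gradient map is
Fréchet differentiable at `s` with derivative the linear map associated with the Hessian
matrix; the last two conjuncts assert symmetry and positive definiteness. -/
theorem hessian_K_function
    (d : ℕ) (hd : 3 ≤ d)
    (ρ : EuclideanSpace ℝ (Fin d) → ℝ)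
    (hρ_meas : Measurable ρ)
    (hρ_nonneg : ∀ x, 0 ≤ ρ x)
    (C : ℝ) (hρ_bdd : ∀ᵐ x ∂volume, ρ x ≤ C)
    (hρ_int : ∫ x, ρ x ∂volume = 1)
    (s : EuclideanSpace ℝ (Fin d))
    (H : Matrix (Fin d) (Fin d) ℝ)
    (hH : H = fun i j => ∫ x,
      ((if i = j then (1 : ℝ) else 0) / ‖s - x‖
        - ((s - x) i * (s - x) j) / ‖s - x‖ ^ 3) * ρ x ∂volume) :
    (∀ t, HasGradientAt (fun u => ∫ x, (‖u - x‖ - ‖x‖) * ρ x ∂volume)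
        (∫ x, (ρ x / ‖t - x‖) • (t - x) ∂volume) t) ∧
    HasFDerivAt (fun t => ∫ x, (ρ x / ‖t - x‖) • (t - x) ∂volume)
      (Matrix.toEuclideanLin H).toContinuousLinearMap s ∧
    H.IsSymm ∧ H.PosDef := by
  have hfin : 2 ≤ Module.finrank ℝ (EuclideanSpace ℝ (Fin d)) := by
    rw [finrank_euclideanSpace_fin]; lia
  have : Nontrivial (EuclideanSpace ℝ (Fin d)) :=
    Module.nontrivial_of_finrank_pos (R := ℝ) (two_pos.trans_le hfin)
  have hρ : Integrable ρ volume := .of_integral_ne_zero (by simp [hρ_int])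
  obtain ⟨hint, hderiv⟩ := hasFDerivAt_integral_inv_norm_smul hfin hρ hρ_nonneg hρ_bdd s
  have hlin : (Matrix.toEuclideanLin H).toContinuousLinearMap
      = ∫ x, ρ x • unitVectorDeriv (s - x) := by
    apply ContinuousLinearMap.coe_injective
    refine (EuclideanSpace.basisFun (Fin d) ℝ).toBasis.ext fun j => ?_
    ext i
    have hcoord := (EuclideanSpace.proj i : EuclideanSpace ℝ (Fin d) →L[ℝ] ℝ).integral_comp_comm
      (hint.apply_continuousLinearMap (EuclideanSpace.single j (1 : ℝ)))
    simp only [OrthonormalBasis.coe_toBasis, EuclideanSpace.basisFun_apply,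
      LinearMap.coe_toContinuousLinearMap, ContinuousLinearMap.coe_coe]
    rw [ContinuousLinearMap.integral_apply hint]
    refine Eq.trans ?_ hcoord
    rw [Matrix.toLpLin_apply, PiLp.ofLp_single, Matrix.mulVec_single_one]
    change H i j = _
    rw [hH]
    refine integral_congr_ae (.of_forall fun x => ?_)
    simp [unitVectorDeriv_apply, EuclideanSpace.inner_single_right]
    split_ifs <;> ring
  have hsymm : H.IsSymm := by
    ext i j
    rw [hH]
    change ∫ x, _ = ∫ x, _
    simp only [eq_comm (a := j), mul_comm ((s - _) j)]
  refine ⟨hasGradientAt_integral_norm_sub hρ hρ_nonneg, hlin ▸ hderiv, hsymm,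
    Matrix.posDef_iff_dotProduct_mulVec.2 ⟨by
      rwa [Matrix.IsHermitian, Matrix.conjTranspose_eq_transpose_of_trivial], fun v hv => ?_⟩⟩
  have hpos := inner_integral_unitVectorDeriv_pos hfin hρ_nonneg (by simp [hρ_int]) s hint
    (v := WithLp.toLp 2 v) (by simpa using hv)
  rw [← hlin, LinearMap.coe_toContinuousLinearMap', Matrix.toLpLin_apply,
    EuclideanSpace.inner_eq_star_dotProduct, dotProduct_comm] at hpos
  exact hpos
end
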